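/- arXiv:2006.03406 — 7 statements merged into one kernel-verified Lean document; each statement's English description precedes it below -/
import Mathlib

section
/- Let T > 0, μ ≥ 0, let φ : ℝ → ℝ be C^∞, T-periodic with zero average over its period, and let h : ℝ × ℝ × ℝ → ℝ be C^∞, bounded, and T-periodic in its last argument. Assume that for all t ∈ ℝ, h(π/2, 0, t) < 1 and h(3π/2, 0, t) > −1. Then there exists K ∈ ℕ such that for every natural number k > K the system q̇ = p − φ(kt)·sin q, ṗ = −μp + (μ sin q + p cos q)·φ(kt) − sin q − (φ(kt)²/2)·sin 2q + h(q, p, t) admits a T-periodic C^∞ solution (q(t), p(t)) with q(t) ∈ (π/2, 3π/2) for all t ∈ ℝ. -/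
open Real

theorem lt_of_preconnected_of_ne {X : Type*} [TopologicalSpace X] {s : Set X}
    (hs : IsPreconnected s) {g : X → ℝ} (hg : ContinuousOn g s) {c : ℝ} (hc : ∀ x ∈ s, g x ≠ c)
    {a b : X} (ha : a ∈ s) (hb : b ∈ s) (hac : g a < c) : g b < c := by
  by_contra! hcb
  obtain ⟨x, hx, hxc⟩ := hs.intermediate_value ha hb hg ⟨hac.le, hcb⟩
  exact hc x hx hxc

theorem gt_of_preconnected_of_ne {X : Type*} [TopologicalSpace X] {s : Set X}
    (hs : IsPreconnected s) {g : X → ℝ} (hg : ContinuousOn g s) {c : ℝ} (hc : ∀ x ∈ s, g x ≠ c)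
    {a b : X} (ha : a ∈ s) (hb : b ∈ s) (hac : c < g a) : c < g b := by
  by_contra! hcb
  obtain ⟨x, hx, hxc⟩ := hs.intermediate_value hb ha hg ⟨hcb, hac.le⟩
  exact hc x hx hxc

/-- A nowhere vanishing continuous map from the plane to `ℂ` has a continuous argument. -/
theorem exists_continuous_polar {f : ℝ × ℝ → ℂ} (hf : Continuous f) (h0 : ∀ z, f z ≠ 0) :
    ∃ r θ : ℝ × ℝ → ℝ, Continuous θ ∧
      ∀ z, 0 < r z ∧ (f z).re = r z * cos (θ z) ∧ (f z).im = r z * sin (θ z) := by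
  obtain ⟨g, ⟨-, hg⟩, -⟩ := Complex.isCoveringMapOn_exp.existsUnique_continuousMap_lifts
    ⟨f, hf⟩ (a₀ := 0) (Complex.exp_log (h0 0)) (fun z => h0 z)
  refine ⟨fun z => Real.exp (g z).re, fun z => (g z).im, by fun_prop, fun z => ?_⟩
  have hz : Complex.exp (g z) = f z := congrFun hg z
  rw [← hz, Complex.exp_re, Complex.exp_im]
  exact ⟨Real.exp_pos _, rfl, rfl⟩

/-- The two-dimensional **Poincaré–Miranda theorem** on the square `[-R, R]²`. -/
theorem poincare_miranda_square {R : ℝ} (hR : 0 ≤ R) {u v : ℝ × ℝ → ℝ}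
    (hu : ContinuousOn u (Set.Icc (-R) R ×ˢ Set.Icc (-R) R))
    (hv : ContinuousOn v (Set.Icc (-R) R ×ˢ Set.Icc (-R) R))
    (hright : ∀ y ∈ Set.Icc (-R) R, 0 < u (R, y)) (hleft : ∀ y ∈ Set.Icc (-R) R, u (-R, y) < 0)
    (htop : ∀ x ∈ Set.Icc (-R) R, 0 < v (x, R)) (hbot : ∀ x ∈ Set.Icc (-R) R, v (x, -R) < 0) :
    ∃ z ∈ Set.Icc (-R) R ×ˢ Set.Icc (-R) R, u z = 0 ∧ v z = 0 := by
  by_contra! hne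
  have hRR : -R ≤ R := by linarith
  set c : ℝ × ℝ → ℝ × ℝ := fun z => (Set.projIcc (-R) R hRR z.1, Set.projIcc (-R) R hRR z.2)
    with hc
  have hcc : Continuous c := by fun_prop
  have hcm : ∀ z, c z ∈ Set.Icc (-R) R ×ˢ Set.Icc (-R) R := fun z =>
    ⟨(Set.projIcc (-R) R hRR z.1).2, (Set.projIcc (-R) R hRR z.2).2⟩
  have hid : ∀ z ∈ Set.Icc (-R) R ×ˢ Set.Icc (-R) R, c z = z := fun z hz => by
    simp only [hc, Set.projIcc_of_mem hRR hz.1, Set.projIcc_of_mem hRR hz.2]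
  have huc : Continuous (fun z => u (c z)) := hu.comp_continuous hcc hcm
  have hvc : Continuous (fun z => v (c z)) := hv.comp_continuous hcc hcm
  obtain ⟨r, θ, hθ, hpol⟩ := exists_continuous_polar
    (f := fun z => (⟨u (c z), v (c z)⟩ : ℂ))
    (Complex.equivRealProdCLM.symm.continuous.comp (huc.prodMk hvc))
    (fun z hz => hne _ (hcm z) (congrArg Complex.re hz) (congrArg Complex.im hz))
  have key : ∀ z ∈ Set.Icc (-R) R ×ˢ Set.Icc (-R) R,
      0 < r z ∧ u z = r z * cos (θ z) ∧ v z = r z * sin (θ z) := fun z hz => by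
    simpa [hid z hz] using hpol z
  have hmem : ∀ a ∈ Set.Icc (-R) R, ∀ b ∈ Set.Icc (-R) R,
      ((a, b) : ℝ × ℝ) ∈ Set.Icc (-R) R ×ˢ Set.Icc (-R) R := fun a ha b hb => ⟨ha, hb⟩
  have hRm : R ∈ Set.Icc (-R) R := ⟨hRR, le_rfl⟩
  have hLm : -R ∈ Set.Icc (-R) R := ⟨le_rfl, hRR⟩
  have cos_right : ∀ y ∈ Set.Icc (-R) R, 0 < cos (θ (R, y)) := fun y hy => by
    obtain ⟨h1, h2, -⟩ := key _ (hmem R hRm y hy)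
    exact (pos_iff_pos_of_mul_pos (h2 ▸ hright y hy)).1 h1
  have cos_left : ∀ y ∈ Set.Icc (-R) R, cos (θ (-R, y)) < 0 := fun y hy => by
    obtain ⟨h1, h2, -⟩ := key _ (hmem (-R) hLm y hy)
    have := hleft y hy
    rw [h2] at this
    exact neg_of_mul_neg_right this h1.le
  have sin_top : ∀ x ∈ Set.Icc (-R) R, 0 < sin (θ (x, R)) := fun y hy => by
    obtain ⟨h1, -, h2⟩ := key _ (hmem y hy R hRm)
    exact (pos_iff_pos_of_mul_pos (h2 ▸ htop y hy)).1 h1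
  have sin_bot : ∀ x ∈ Set.Icc (-R) R, sin (θ (x, -R)) < 0 := fun y hy => by
    obtain ⟨h1, -, h2⟩ := key _ (hmem y hy (-R) hLm)
    have := hbot y hy
    rw [h2] at this
    exact neg_of_mul_neg_right this h1.le
  set s := toIcoDiv two_pi_pos (-π) (θ (R, R)) with hs
  set ψ : ℝ × ℝ → ℝ := fun z => θ z - s * (2 * π) with hψ
  have hψc : Continuous ψ := by fun_prop
  have hcos : ∀ z, cos (ψ z) = cos (θ z) := fun z => cos_sub_int_mul_two_pi _ _
  have hsin : ∀ z, sin (ψ z) = sin (θ z) := fun z => sin_sub_int_mul_two_pi _ _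
  simp only [← hcos] at cos_right cos_left
  simp only [← hsin] at sin_top sin_bot
  have h0 : ψ (R, R) ∈ Set.Ico (-π) (-π + 2 * π) := by
    have := sub_toIcoDiv_zsmul_mem_Ico two_pi_pos (-π) (θ (R, R))
    simpa [hψ, hs] using this
  have hpi := Real.pi_pos
  have hA0 : 0 < ψ (R, R) := by
    by_contra! hle
    exact (sin_top R hRm).not_ge (sin_nonpos_of_nonpos_of_neg_pi_le hle h0.1)
  have hA1 : ψ (R, R) < π / 2 := by
    by_contra! hle
    exact (cos_right R hRm).not_ge (cos_nonpos_of_pi_div_two_le_of_le hle (by linarith [h0.2]))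
  have edge_h : ∀ b, IsPreconnected ((fun x : ℝ => ((x, b) : ℝ × ℝ)) '' Set.Icc (-R) R) :=
    fun b => isPreconnected_Icc.image _ (by fun_prop)
  have edge_v : ∀ a, IsPreconnected ((fun y : ℝ => ((a, y) : ℝ × ℝ)) '' Set.Icc (-R) R) :=
    fun a => isPreconnected_Icc.image _ (by fun_prop)
  have hB1 : ψ (-R, R) < π := by
    refine lt_of_preconnected_of_ne (edge_h R) hψc.continuousOn ?_ ⟨R, hRm, rfl⟩ ⟨-R, hLm, rfl⟩
      (by linarith)
    rintro _ ⟨x, hx, rfl⟩ h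
    simpa [h] using sin_top x hx
  have hC1 : ψ (-R, -R) < 3 * π / 2 := by
    refine lt_of_preconnected_of_ne (edge_v (-R)) hψc.continuousOn ?_ ⟨R, hRm, rfl⟩
      ⟨-R, hLm, rfl⟩ (by linarith)
    rintro _ ⟨x, hx, rfl⟩ h
    have := cos_left x hx
    rw [h, show 3 * π / 2 = π / 2 + π by ring, cos_add_pi] at this
    simp at this
  have hBpos : π / 2 < ψ (-R, R) := by
    have h1 : 0 < ψ (-R, R) := by
      refine gt_of_preconnected_of_ne (edge_h R) hψc.continuousOn ?_ ⟨R, hRm, rfl⟩ ⟨-R, hLm, rfl⟩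
        hA0
      rintro _ ⟨x, hx, rfl⟩ h
      simpa [h] using sin_top x hx
    by_contra! hle
    exact (cos_left R hRm).not_ge (cos_nonneg_of_neg_pi_div_two_le_of_le (by linarith) hle)
  have hC0 : π / 2 < ψ (-R, -R) := by
    refine gt_of_preconnected_of_ne (edge_v (-R)) hψc.continuousOn ?_ ⟨R, hRm, rfl⟩
      ⟨-R, hLm, rfl⟩ hBpos
    rintro _ ⟨x, hx, rfl⟩ h
    simpa [h] using cos_left x hx
  have hC2 : π < ψ (-R, -R) := by
    by_contra! hle
    exact (sin_bot (-R) hLm).not_ge (sin_nonneg_of_nonneg_of_le_pi (by linarith) hle)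
  have hD0 : π < ψ (R, -R) := by
    refine gt_of_preconnected_of_ne (edge_h (-R)) hψc.continuousOn ?_ ⟨-R, hLm, rfl⟩
      ⟨R, hRm, rfl⟩ hC2
    rintro _ ⟨x, hx, rfl⟩ h
    simpa [h] using sin_bot x hx
  have hE := lt_of_preconnected_of_ne (edge_v R) hψc.continuousOn (c := π / 2) ?_
      ⟨R, hRm, rfl⟩ ⟨-R, hLm, rfl⟩ hA1
  · linarith
  rintro _ ⟨x, hx, rfl⟩ h
  simpa [h] using cos_right x hx

/-- A Picard–Lindelöf flow on `[0, T]` for a bounded, locally Lipschitz vector field. -/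
theorem exists_flow_of_bounded {E : Type*} [NormedAddCommGroup E] [NormedSpace ℝ E]
    [ProperSpace E] {T L R : ℝ} (hT : 0 < T) (hL : 0 ≤ L) (hR : 0 ≤ R) {f : ℝ → E → E}
    (hlip : LocallyLipschitz (fun z : ℝ × E => f z.1 z.2)) (hbd : ∀ t x, ‖f t x‖ ≤ L) :
    ∃ Φ : E × ℝ → E, (∀ x ∈ Metric.closedBall (0 : E) R, Φ (x, 0) = x ∧
      ∀ t ∈ Set.Icc 0 T,
        HasDerivWithinAt (fun s => Φ (x, s)) (f t (Φ (x, t))) (Set.Icc 0 T) t) ∧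
      ContinuousOn Φ (Metric.closedBall (0 : E) R ×ˢ Set.Icc 0 T) := by
  have hcomp : IsCompact (Set.Icc 0 T ×ˢ Metric.closedBall (0 : E) (R + L * T)) :=
    isCompact_Icc.prod (isCompact_closedBall _ _)
  obtain ⟨K, hK⟩ := hlip.locallyLipschitzOn.exists_lipschitzOnWith_of_compact hcomp
  have hPL : IsPicardLindelof f (tmin := 0) (tmax := T) ⟨0, le_rfl, hT.le⟩ (0 : E)
      ⟨R + L * T, by positivity⟩ ⟨R, hR⟩ ⟨L, hL⟩ K := by
    refine ⟨fun t ht x hx y hy => ?_, fun x _ => ?_, fun t _ x _ => hbd t x, ?_⟩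
    · have := hK (x := (t, x)) ⟨ht, hx⟩ (y := (t, y)) ⟨ht, hy⟩
      simpa [Prod.edist_eq] using this
    · exact (hlip.continuous.comp (by fun_prop : Continuous fun t : ℝ => (t, x))).continuousOn
    · simp only [sub_zero, sub_self, max_eq_left hT.le]
      change L * T ≤ R + L * T - R
      linarith
  exact hPL.exists_forall_mem_closedBall_eq_hasDerivWithinAt_continuousOn

/-- A solution on `[0, T]` of a `T`-periodic equation with equal endpoint values extends to a
global `T`-periodic solution. -/
theorem exists_periodic_extension {E : Type*} [NormedAddCommGroup E] [NormedSpace ℝ E]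
    [CompleteSpace E] {T : ℝ} (hT : 0 < T) {f : ℝ → E → E}
    (hf : Continuous (fun z : ℝ × E => f z.1 z.2)) (hper : ∀ t x, f (t + T) x = f t x)
    {y : ℝ → E}
    (hy : ∀ t ∈ Set.Icc 0 T, HasDerivWithinAt y (f t (y t)) (Set.Icc 0 T) t)
    (hend : y 0 = y T) :
    ∃ x : ℝ → E, Function.Periodic x T ∧ ∀ t, HasDerivAt x (f t (x t)) t := by
  have : Fact (0 < T) := ⟨hT⟩
  have hyc : ContinuousOn y (Set.Icc 0 T) := fun t ht => (hy t ht).continuousWithinAt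
  set X : ℝ → E := fun t => AddCircle.liftIco T 0 y (t : AddCircle T) with hX
  have hXc : Continuous X :=
    (AddCircle.liftIco_zero_continuous hend hyc).comp (AddCircle.continuous_mk' T)
  have hXp : Function.Periodic X T := fun t => by simp [hX]
  have hXy : ∀ t ∈ Set.Icc 0 T, X t = y t := by
    intro t ht
    rcases ht.2.lt_or_eq with h | h
    · exact AddCircle.liftIco_zero_coe_apply ⟨ht.1, h⟩
    · have h0 : X 0 = y 0 := AddCircle.liftIco_zero_coe_apply ⟨le_rfl, hT⟩
      have := hXp 0
      rw [zero_add] at this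
      rw [h, this, h0, hend]
  set g : ℝ → E := fun t => f t (X t) with hg
  have hgc : Continuous g := hf.comp (continuous_id.prodMk hXc)
  have hgp : Function.Periodic g T := fun t => by simp only [hg, hXp t, hper]
  have hint : ∀ t ∈ Set.Icc 0 T, ∫ s in (0 : ℝ)..t, g s = X t - X 0 := by
    intro t ht
    rw [hXy t ht, hXy 0 ⟨le_rfl, hT.le⟩]
    refine intervalIntegral.integral_eq_sub_of_hasDerivAt_of_le ht.1
      (hyc.mono (Set.Icc_subset_Icc_right ht.2)) (fun s hs => ?_) (hgc.intervalIntegrable _ _)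
    have hs' : s ∈ Set.Ioo 0 T := ⟨hs.1, hs.2.trans_le ht.2⟩
    have := (hy s (Set.Ioo_subset_Icc_self hs')).hasDerivAt (Icc_mem_nhds hs'.1 hs'.2)
    simpa only [hg, hXy s (Set.Ioo_subset_Icc_self hs')] using this
  have hzero : ∫ s in (0 : ℝ)..T, g s = 0 := by
    rw [hint T ⟨hT.le, le_rfl⟩, sub_eq_zero]
    simpa using hXp 0
  set Y : ℝ → E := fun t => X 0 + ∫ s in (0 : ℝ)..t, g s with hY
  have hYp : Function.Periodic Y T := fun t => by
    simp only [hY]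
    rw [← intervalIntegral.integral_add_adjacent_intervals (hgc.intervalIntegrable 0 t)
      (hgc.intervalIntegrable t (t + T)), hgp.intervalIntegral_add_eq t 0, zero_add, hzero,
      add_zero]
  have hYX : Y = X := by
    have hsub : Function.Periodic (fun t => Y t - X t) T := fun t => by simp only [hYp t, hXp t]
    funext t
    obtain ⟨s, hs, hts⟩ := hsub.exists_mem_Ico₀ hT t
    have := hint s ⟨hs.1, hs.2.le⟩
    rw [← sub_eq_zero, hts]
    simp [hY, this]
  refine ⟨X, hXp, fun t => ?_⟩
  have := (intervalIntegral.integral_hasDerivAt_right (hgc.intervalIntegrable 0 t)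
    (hgc.stronglyMeasurableAtFilter _ _) hgc.continuousAt).const_add (X 0)
  rw [← hYX]
  convert this using 1
  simp only [hg, hYX]

theorem lt_of_hasDerivWithinAt_pos {T : ℝ} (hT : 0 < T) {y y' : ℝ → ℝ}
    (hy : ∀ t ∈ Set.Icc 0 T, HasDerivWithinAt y (y' t) (Set.Icc 0 T) t)
    (hpos : ∀ t ∈ Set.Icc 0 T, 0 < y' t) : y 0 < y T := by
  refine strictMonoOn_of_hasDerivWithinAt_pos (convex_Icc 0 T)
    (fun t ht => (hy t ht).continuousWithinAt)
    (fun t ht => (hy t (interior_subset ht)).mono interior_subset)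
    (fun t ht => hpos t (interior_subset ht)) ⟨le_rfl, hT.le⟩ ⟨hT.le, le_rfl⟩ hT

theorem lt_of_hasDerivWithinAt_neg {T : ℝ} (hT : 0 < T) {y y' : ℝ → ℝ}
    (hy : ∀ t ∈ Set.Icc 0 T, HasDerivWithinAt y (y' t) (Set.Icc 0 T) t)
    (hneg : ∀ t ∈ Set.Icc 0 T, y' t < 0) : y T < y 0 := by
  have := lt_of_hasDerivWithinAt_pos hT (fun t ht => (hy t ht).neg)
    (fun t ht => neg_pos.2 (hneg t ht))
  simpa using this

/-- A bounded planar periodic vector field which points outward in the second coordinate for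
large first coordinate, and in the first coordinate for large second coordinate, has a periodic
solution. -/
theorem exists_periodic_solution_of_bounded {T L R₀ : ℝ} (hT : 0 < T) (hL : 0 ≤ L)
    (hR₀ : 0 ≤ R₀) {f : ℝ → ℝ × ℝ → ℝ × ℝ}
    (hlip : LocallyLipschitz (fun z : ℝ × (ℝ × ℝ) => f z.1 z.2))
    (hbd : ∀ t x, ‖f t x‖ ≤ L) (hper : ∀ t x, f (t + T) x = f t x)
    (hright : ∀ t q v, R₀ ≤ q → 0 < (f t (q, v)).2)
    (hleft : ∀ t q v, q ≤ -R₀ → (f t (q, v)).2 < 0)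
    (htop : ∀ t q v, R₀ ≤ v → 0 < (f t (q, v)).1)
    (hbot : ∀ t q v, v ≤ -R₀ → (f t (q, v)).1 < 0) :
    ∃ x : ℝ → ℝ × ℝ, Function.Periodic x T ∧ ∀ t, HasDerivAt x (f t (x t)) t := by
  set R := R₀ + L * T with hRdef
  have hR : 0 ≤ R := by positivity
  obtain ⟨Φ, hΦ, hΦc⟩ := exists_flow_of_bounded hT hL hR hlip hbd
  have hball : Metric.closedBall (0 : ℝ × ℝ) R = Set.Icc (-R) R ×ˢ Set.Icc (-R) R := by
    rw [← Prod.mk_zero_zero, ← closedBall_prod_same, Real.closedBall_eq_Icc]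
    simp
  rw [hball] at hΦ hΦc
  have hTm : T ∈ Set.Icc 0 T := ⟨hT.le, le_rfl⟩
  have hdist : ∀ z ∈ Set.Icc (-R) R ×ˢ Set.Icc (-R) R, ∀ t ∈ Set.Icc 0 T,
      ‖Φ (z, t) - z‖ ≤ L * T := by
    intro z hz t ht
    have := norm_image_sub_le_of_norm_deriv_le_segment' (f := fun s => Φ (z, s)) (C := L)
      (hΦ z hz).2 (fun s _ => hbd _ _) t ht
    simp only [(hΦ z hz).1, sub_zero] at this
    exact this.trans (mul_le_mul_of_nonneg_left ht.2 hL)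
  have hd1 : ∀ z ∈ Set.Icc (-R) R ×ˢ Set.Icc (-R) R, ∀ t ∈ Set.Icc 0 T,
      |(Φ (z, t)).1 - z.1| ≤ L * T := fun z hz t ht =>
    (norm_fst_le (Φ (z, t) - z)).trans (hdist z hz t ht)
  have hd2 : ∀ z ∈ Set.Icc (-R) R ×ˢ Set.Icc (-R) R, ∀ t ∈ Set.Icc 0 T,
      |(Φ (z, t)).2 - z.2| ≤ L * T := fun z hz t ht =>
    (norm_snd_le (Φ (z, t) - z)).trans (hdist z hz t ht)
  have hDer1 : ∀ z ∈ Set.Icc (-R) R ×ˢ Set.Icc (-R) R, ∀ t ∈ Set.Icc 0 T,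
      HasDerivWithinAt (fun s => (Φ (z, s)).1) (f t (Φ (z, t))).1 (Set.Icc 0 T) t :=
    fun z hz t ht => ((hΦ z hz).2 t ht).fst
  have hDer2 : ∀ z ∈ Set.Icc (-R) R ×ˢ Set.Icc (-R) R, ∀ t ∈ Set.Icc 0 T,
      HasDerivWithinAt (fun s => (Φ (z, s)).2) (f t (Φ (z, t))).2 (Set.Icc 0 T) t :=
    fun z hz t ht => ((hΦ z hz).2 t ht).snd
  have hcont : ContinuousOn (fun z => Φ (z, T) - z) (Set.Icc (-R) R ×ˢ Set.Icc (-R) R) :=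
    (hΦc.comp (by fun_prop : Continuous fun z : ℝ × ℝ => (z, T)).continuousOn
      (fun z hz => ⟨hz, hTm⟩)).sub continuousOn_id
  have hRm : R ∈ Set.Icc (-R) R := ⟨by linarith, le_rfl⟩
  have hLm : -R ∈ Set.Icc (-R) R := ⟨le_rfl, by linarith⟩
  obtain ⟨z, hz, h2, h1⟩ := poincare_miranda_square hR
    (u := fun z => (Φ (z, T) - z).2) (v := fun z => (Φ (z, T) - z).1)
    (continuous_snd.comp_continuousOn hcont) (continuous_fst.comp_continuousOn hcont)
    (fun y hy => by
      have hz : ((R, y) : ℝ × ℝ) ∈ Set.Icc (-R) R ×ˢ Set.Icc (-R) R := ⟨hRm, hy⟩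
      have := lt_of_hasDerivWithinAt_pos hT (hDer2 _ hz) (fun t ht =>
        hright t _ _ (by have := (abs_le.1 (hd1 _ hz t ht)).1; simp only at this; linarith))
      simpa [(hΦ _ hz).1] using this)
    (fun y hy => by
      have hz : ((-R, y) : ℝ × ℝ) ∈ Set.Icc (-R) R ×ˢ Set.Icc (-R) R := ⟨hLm, hy⟩
      have := lt_of_hasDerivWithinAt_neg hT (hDer2 _ hz) (fun t ht =>
        hleft t _ _ (by have := (abs_le.1 (hd1 _ hz t ht)).2; simp only at this; linarith))
      simpa [(hΦ _ hz).1] using this)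
    (fun y hy => by
      have hz : ((y, R) : ℝ × ℝ) ∈ Set.Icc (-R) R ×ˢ Set.Icc (-R) R := ⟨hy, hRm⟩
      have := lt_of_hasDerivWithinAt_pos hT (hDer1 _ hz) (fun t ht =>
        htop t _ _ (by have := (abs_le.1 (hd2 _ hz t ht)).1; simp only at this; linarith))
      simpa [(hΦ _ hz).1] using this)
    (fun y hy => by
      have hz : ((y, -R) : ℝ × ℝ) ∈ Set.Icc (-R) R ×ˢ Set.Icc (-R) R := ⟨hy, hLm⟩
      have := lt_of_hasDerivWithinAt_neg hT (hDer1 _ hz) (fun t ht =>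
        hbot t _ _ (by have := (abs_le.1 (hd2 _ hz t ht)).2; simp only at this; linarith))
      simpa [(hΦ _ hz).1] using this)
  refine exists_periodic_extension hT hlip.continuous hper (hΦ z hz).2 ?_
  rw [(hΦ z hz).1]
  exact (sub_eq_zero.1 (Prod.ext h1 h2)).symm

theorem Function.Periodic.deriv {g : ℝ → ℝ} {T : ℝ} (hg : Function.Periodic g T) :
    Function.Periodic (deriv g) T := fun t => by
  rw [← deriv_comp_add_const]
  exact congrArg (fun g => _root_.deriv g t) (funext hg)

theorem exists_abs_le_of_periodic {T : ℝ} (hT : 0 < T) {g : ℝ → ℝ} (hg : Continuous g)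
    (hper : Function.Periodic g T) : ∃ C, 0 ≤ C ∧ ∀ t, |g t| ≤ C := by
  obtain ⟨C, hC⟩ := isCompact_Icc.exists_bound_of_continuousOn (s := Set.Icc 0 T) hg.continuousOn
  refine ⟨C, (norm_nonneg _).trans (hC 0 ⟨le_rfl, hT.le⟩), fun t => ?_⟩
  obtain ⟨s, hs, hts⟩ := hper.exists_mem_Ico₀ hT t
  rw [hts]
  exact hC s ⟨hs.1, hs.2.le⟩

theorem exists_forall_le_of_periodic {T : ℝ} (hT : 0 < T) {g : ℝ → ℝ} (hg : Continuous g)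
    (hper : Function.Periodic g T) : ∃ t₀, ∀ t, g t ≤ g t₀ := by
  obtain ⟨t₀, -, ht₀⟩ := isCompact_Icc.exists_isMaxOn (s := Set.Icc 0 T)
    ⟨0, le_rfl, hT.le⟩ hg.continuousOn
  refine ⟨t₀, fun t => ?_⟩
  obtain ⟨s, hs, hts⟩ := hper.exists_mem_Ico₀ hT t
  rw [hts]
  exact ht₀ ⟨hs.1, hs.2.le⟩

/-- A maximum principle: a periodic function is nonpositive if its derivative has the sign of a
function `w` to the right of every positive critical point, where `w` crosses zero upward. -/
theorem nonpos_of_periodic_of_crossing {T : ℝ} (hT : 0 < T) {d d' w w' : ℝ → ℝ}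
    (hper : Function.Periodic d T) (hd : ∀ t, HasDerivAt d (d' t) t)
    (hw : ∀ t, HasDerivAt w (w' t) t) (hsign : ∀ t, 0 < w t → 0 < d' t)
    (hcross : ∀ t, 0 < d t → d' t = 0 → w t = 0 ∧ 0 < w' t) (t : ℝ) : d t ≤ 0 := by
  have hdc : Continuous d := continuous_iff_continuousAt.2 fun t => (hd t).continuousAt
  obtain ⟨t₀, ht₀⟩ := exists_forall_le_of_periodic hT hdc hper
  by_contra! hpos
  have hmax : IsLocalMax d t₀ := Filter.Eventually.of_forall ht₀
  obtain ⟨hw0, hw1⟩ := hcross t₀ (hpos.trans_le (ht₀ t)) (hmax.hasDerivAt_eq_zero (hd t₀))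
  have hev : ∀ᶠ s in nhdsWithin t₀ (Set.Ioi t₀), 0 < w s := by
    have hslope := (hasDerivAt_iff_tendsto_slope.1 (hw t₀)).mono_left
      (nhdsWithin_mono t₀ (s := Set.Ioi t₀) fun s hs => ne_of_gt hs)
    filter_upwards [hslope.eventually (lt_mem_nhds hw1), self_mem_nhdsWithin] with s hs hs'
    rw [slope_def_field, hw0, sub_zero] at hs
    exact (div_pos_iff_of_pos_right (sub_pos.2 hs')).1 hs
  obtain ⟨b, hb, hbs⟩ := mem_nhdsGT_iff_exists_Ioc_subset.1 hev
  have hmono : StrictMonoOn d (Set.Icc t₀ b) := by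
    refine strictMonoOn_of_hasDerivWithinAt_pos (convex_Icc _ _) hdc.continuousOn
      (fun s _ => (hd s).hasDerivWithinAt) (fun s hs => hsign s (hbs ?_))
    rw [interior_Icc] at hs
    exact ⟨hs.1, hs.2.le⟩
  exact (ht₀ b).not_gt (hmono ⟨le_rfl, (le_of_lt hb)⟩ ⟨le_of_lt hb, le_rfl⟩ hb)

/-- The method of lower and upper solutions for periodic solutions of the second-order equation
`deriv v = -μ * v + B t q v`, `v = deriv q`, with bounded `B`. -/
theorem exists_periodic_between_lower_upper {T μ A : ℝ} (hT : 0 < T) (hμ : 0 ≤ μ)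
    {B : ℝ → ℝ → ℝ → ℝ} (hB : ContDiff ℝ 1 (fun z : ℝ × ℝ × ℝ => B z.1 z.2.1 z.2.2))
    (hBper : ∀ t q v, B (t + T) q v = B t q v) (hBbd : ∀ t q v, |B t q v| ≤ A)
    {α β : ℝ → ℝ} (hα : ContDiff ℝ 2 α) (hβ : ContDiff ℝ 2 β)
    (hαper : Function.Periodic α T) (hβper : Function.Periodic β T)
    (hαβ : ∀ t, α t ≤ β t)
    (hαlow : ∀ t, -μ * deriv α t + B t (α t) (deriv α t) ≤ deriv (deriv α) t)
    (hβupp : ∀ t, deriv (deriv β) t ≤ -μ * deriv β t + B t (β t) (deriv β t)) :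
    ∃ q v : ℝ → ℝ, Function.Periodic q T ∧ Function.Periodic v T ∧
      (∀ t, HasDerivAt q (v t) t) ∧ (∀ t, HasDerivAt v (-μ * v t + B t (q t) (v t)) t) ∧
      ∀ t, α t ≤ q t ∧ q t ≤ β t := by
  have hA : 0 ≤ A := (abs_nonneg _).trans (hBbd 0 0 0)
  have deriv_data : ∀ {γ : ℝ → ℝ}, ContDiff ℝ 2 γ → (∀ t, HasDerivAt γ (deriv γ t) t) ∧
      (∀ t, HasDerivAt (deriv γ) (deriv (deriv γ) t) t) := fun hγ =>
    ⟨fun t => (hγ.differentiable (by norm_num) t).hasDerivAt, fun t =>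
      ((((contDiff_succ_iff_deriv (n := 1)).1 hγ).2.2.differentiable one_ne_zero) t).hasDerivAt⟩
  obtain ⟨hα1, hα2⟩ := deriv_data hα
  obtain ⟨hβ1, hβ2⟩ := deriv_data hβ
  obtain ⟨Da, hDa0, hDa⟩ := exists_abs_le_of_periodic hT hα.continuous hαper
  obtain ⟨Db, hDb0, hDb⟩ := exists_abs_le_of_periodic hT hβ.continuous hβper
  obtain ⟨Na, hNa0, hNa⟩ := exists_abs_le_of_periodic hT
    (hα.continuous_deriv (by norm_num)) hαper.deriv
  obtain ⟨Nb, hNb0, hNb⟩ := exists_abs_le_of_periodic hT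
    (hβ.continuous_deriv (by norm_num)) hβper.deriv
  set D := Da + Db with hD
  set N := Na + Nb + (A * T + μ * (2 * D)) + 1 with hN
  have hD0 : 0 ≤ D := by positivity
  have hAT : 0 ≤ A * T + μ * (2 * D) := by positivity
  have hN0 : 0 < N := by linarith
  set M := μ * N + A + 1 with hM
  have hM0 : 0 < M := by positivity
  set c : ℝ → ℝ → ℝ := fun K v => max (-K) (min v K) with hc
  set γ : ℝ → ℝ → ℝ := fun t q => max (α t) (min q (β t)) with hγ
  set f : ℝ → ℝ × ℝ → ℝ × ℝ := fun t x =>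
    (c N x.2, -μ * c N x.2 + B t (γ t x.1) (c N x.2) + c M (x.1 - γ t x.1)) with hf
  have c_abs : ∀ {K} v, 0 ≤ K → |c K v| ≤ K := fun {K} v hK =>
    abs_le.2 ⟨le_max_left _ _, max_le (by linarith) (min_le_right _ _)⟩
  have c_eq : ∀ {K v}, |v| ≤ K → c K v = v := fun {K v} h => by
    rw [abs_le] at h
    simp only [hc]
    rw [min_eq_left h.2, max_eq_right h.1]
  have lt_c : ∀ {K a v}, a < v → a < K → a < c K v := fun h h' =>
    (lt_min h h').trans_le (le_max_right _ _)
  have c_lt : ∀ {K a v}, v < a → -K < a → c K v < a := fun h h' =>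
    max_lt h' ((min_le_left _ _).trans_lt h)
  have c_inj : ∀ {K a v}, |a| < K → c K v = a → v = a := fun {K a v} ha h => by
    rw [abs_lt] at ha
    rcases lt_trichotomy v a with h' | h' | h'
    · exact absurd h (c_lt h' ha.1).ne
    · exact h'
    · exact absurd h (lt_c h' ha.2).ne'
  have hNα : ∀ t, |deriv α t| < N := fun t => (hNa t).trans_lt (by linarith)
  have hNβ : ∀ t, |deriv β t| < N := fun t => (hNb t).trans_lt (by linarith)
  have hγD : ∀ t q, |γ t q| ≤ D := fun t q => by
    have h1 := abs_le.1 (hDa t)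
    have h2 := abs_le.1 (hDb t)
    refine abs_le.2 ⟨le_max_of_le_left (by linarith), max_le (by linarith) ?_⟩
    exact (min_le_right _ _).trans (by linarith)
  have hμc : ∀ v, |μ * c N v| ≤ μ * N := fun v => by
    rw [abs_mul, abs_of_nonneg hμ]
    exact mul_le_mul_of_nonneg_left (c_abs v hN0.le) hμ
  have hlip : LocallyLipschitz (fun z : ℝ × (ℝ × ℝ) => f z.1 z.2) := by
    have l1 : LocallyLipschitz (fun z : ℝ × (ℝ × ℝ) => z.1) :=
      LipschitzWith.prod_fst.locallyLipschitz
    have l2 : LocallyLipschitz (fun z : ℝ × (ℝ × ℝ) => z.2.1) :=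
      (LipschitzWith.prod_fst.comp LipschitzWith.prod_snd).locallyLipschitz
    have l3 : LocallyLipschitz (fun z : ℝ × (ℝ × ℝ) => z.2.2) :=
      (LipschitzWith.prod_snd.comp LipschitzWith.prod_snd).locallyLipschitz
    have lγ : LocallyLipschitz (fun z : ℝ × (ℝ × ℝ) => γ z.1 z.2.1) :=
      ((hα.of_le (by norm_num)).locallyLipschitz.comp l1).max
        (l2.min ((hβ.of_le (by norm_num)).locallyLipschitz.comp l1))
    have lc : LocallyLipschitz (fun z : ℝ × (ℝ × ℝ) => c N z.2.2) :=
      (l3.min_const N).const_max (-N)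
    have lsub : LocallyLipschitz (fun z : ℝ × (ℝ × ℝ) => z.2.1 - γ z.1 z.2.1) :=
      (by fun_prop : ContDiff ℝ 1 (fun y : ℝ × ℝ => y.1 - y.2)).locallyLipschitz.comp
        (l2.prodMk lγ)
    have lM : LocallyLipschitz (fun z : ℝ × (ℝ × ℝ) => c M (z.2.1 - γ z.1 z.2.1)) :=
      (lsub.min_const M).const_max (-M)
    have lB : LocallyLipschitz (fun z : ℝ × (ℝ × ℝ) => B z.1 (γ z.1 z.2.1) (c N z.2.2)) :=
      hB.locallyLipschitz.comp (l1.prodMk (lγ.prodMk lc))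
    have hcomb : ContDiff ℝ 1 (fun y : ℝ × ℝ × ℝ => -μ * y.1 + y.2.1 + y.2.2) := by fun_prop
    exact lc.prodMk (hcomb.locallyLipschitz.comp (lc.prodMk (lB.prodMk lM)))
  obtain ⟨x, hxper, hx⟩ := exists_periodic_solution_of_bounded (T := T)
    (L := N + (μ * N + A + M)) (R₀ := D + M + N) hT (by positivity) (by positivity) hlip
    (fun t x => by
      have h1 := abs_le.1 (hμc x.2)
      have h2 := abs_le.1 (hBbd t (γ t x.1) (c N x.2))
      have h3 := abs_le.1 (c_abs (x.1 - γ t x.1) hM0.le)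
      have h4 : 0 ≤ μ * N := by positivity
      refine max_le ((c_abs _ hN0.le).trans (by linarith)) (abs_le.2 ⟨?_, ?_⟩) <;>
        simp only [hf] <;> linarith)
    (fun t x => by simp only [hf, hγ, hαper t, hβper t, hBper])
    (fun t q v hq => by
      have h1 := abs_le.1 (hμc v)
      have h2 := abs_le.1 (hBbd t (γ t q) (c N v))
      have h3 := abs_le.1 (hγD t q)
      have h4 : M ≤ c M (q - γ t q) := le_max_of_le_right (le_min (by linarith) le_rfl)
      simp only [hf]; linarith)
    (fun t q v hq => by
      have h1 := abs_le.1 (hμc v)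
      have h2 := abs_le.1 (hBbd t (γ t q) (c N v))
      have h3 := abs_le.1 (hγD t q)
      have h4 : c M (q - γ t q) ≤ -M := max_le le_rfl ((min_le_left _ _).trans (by linarith))
      simp only [hf]; linarith)
    (fun t q v hv => lt_c (by linarith) hN0)
    (fun t q v hv => c_lt (by linarith) (by linarith))
  set q : ℝ → ℝ := fun t => (x t).1 with hq
  set v : ℝ → ℝ := fun t => (x t).2 with hv
  have hqper : Function.Periodic q T := fun t => by simp only [hq, hxper t]
  have hvper : Function.Periodic v T := fun t => by simp only [hv, hxper t]
  have hq1 : ∀ t, HasDerivAt q (c N (v t)) t := fun t => (hx t).fst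
  have hv1 : ∀ t, HasDerivAt v
      (-μ * c N (v t) + B t (γ t (q t)) (c N (v t)) + c M (q t - γ t (q t))) t :=
    fun t => (hx t).snd
  have hupper : ∀ t, q t - β t ≤ 0 := by
    refine nonpos_of_periodic_of_crossing hT (hqper.sub hβper) (fun t => (hq1 t).sub (hβ1 t))
      (fun t => (hv1 t).sub (hβ2 t)) (fun t h => sub_pos.2 (lt_c (sub_pos.1 h)
        (abs_lt.1 (hNβ t)).2)) (fun t h h' => ?_)
    replace h : β t < q t := sub_pos.1 h
    have hvt : v t = deriv β t := c_inj (hNβ t) (sub_eq_zero.1 h')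
    have hγt : γ t (q t) = β t := by
      simp only [hγ]
      rw [min_eq_right h.le, max_eq_right (hαβ t)]
    refine ⟨sub_eq_zero.2 hvt, ?_⟩
    rw [hγt, sub_eq_zero.1 h']
    have h1 : 0 < c M (q t - β t) := lt_c (sub_pos.2 h) hM0
    linarith [hβupp t]
  have hlower : ∀ t, α t - q t ≤ 0 := by
    refine nonpos_of_periodic_of_crossing hT (hαper.sub hqper) (fun t => (hα1 t).sub (hq1 t))
      (fun t => (hα2 t).sub (hv1 t)) (fun t h => sub_pos.2 (c_lt (sub_pos.1 h)
        (abs_lt.1 (hNα t)).1)) (fun t h h' => ?_)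
    replace h : q t < α t := sub_pos.1 h
    have hvt : v t = deriv α t := c_inj (hNα t) (sub_eq_zero.1 h').symm
    have hγt : γ t (q t) = α t := by
      simp only [hγ]
      exact max_eq_left ((min_le_left _ _).trans h.le)
    refine ⟨sub_eq_zero.2 hvt.symm, ?_⟩
    rw [hγt, ← sub_eq_zero.1 h']
    have h1 : c M (q t - α t) < 0 := c_lt (sub_neg.2 h) (by linarith)
    linarith [hαlow t]
  have hbetween : ∀ t, α t ≤ q t ∧ q t ≤ β t := fun t =>
    ⟨by linarith [hlower t], by linarith [hupper t]⟩
  have hγq : ∀ t, γ t (q t) = q t := fun t => by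
    simp only [hγ]
    rw [min_eq_left (hbetween t).2, max_eq_right (hbetween t).1]
  have hv2 : ∀ t, HasDerivAt v (-μ * c N (v t) + B t (q t) (c N (v t))) t := fun t => by
    have h0 : c M 0 = 0 := c_eq (by simpa using hM0.le)
    have := hv1 t
    rwa [hγq, sub_self, h0, add_zero] at this
  have hqD : ∀ t, |q t| ≤ D := fun t => hγq t ▸ hγD t (q t)
  have hvN : ∀ t, |v t| ≤ N := by
    intro t
    obtain ⟨t₀, ht₀⟩ := exists_forall_le_of_periodic hT
      (continuous_iff_continuousAt.2 fun t => (hq1 t).continuousAt) hqper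
    have hmax : IsLocalMax q t₀ := Filter.Eventually.of_forall ht₀
    have hv0 : v t₀ = 0 := c_inj (by simpa using hN0) (hmax.hasDerivAt_eq_zero (hq1 t₀))
    obtain ⟨s, hs, hts⟩ := hvper.exists_mem_Ico hT t t₀
    have hest := norm_image_sub_le_of_norm_deriv_le_segment' (f := fun s => v s + μ * q s) (C := A)
      (a := t₀) (b := t₀ + T)
      (fun s _ => ((hv2 s).add ((hq1 s).const_mul μ)).hasDerivWithinAt)
      (fun s _ => by
        rw [show -μ * c N (v s) + B s (q s) (c N (v s)) + μ * c N (v s)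
          = B s (q s) (c N (v s)) by ring]
        exact hBbd _ _ _) s ⟨hs.1, hs.2.le⟩
    rw [Real.norm_eq_abs, hv0] at hest
    have h1 := abs_le.1 (hqD s)
    have h2 := abs_le.1 (hqD t₀)
    have h3 : A * (s - t₀) ≤ A * T := mul_le_mul_of_nonneg_left (by linarith [hs.2]) hA
    have h4 := abs_le.1 hest
    have h5 : μ * (q s - q t₀) ≤ μ * (2 * D) := mul_le_mul_of_nonneg_left (by linarith) hμ
    have h6 : μ * (q t₀ - q s) ≤ μ * (2 * D) := mul_le_mul_of_nonneg_left (by linarith) hμ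
    rw [hts]
    exact abs_le.2 ⟨by linarith, by linarith⟩
  have hcv : ∀ t, c N (v t) = v t := fun t => c_eq (hvN t)
  simp only [hcv] at hq1 hv2
  exact ⟨q, v, hqper, hvper, hq1, hv2, hbetween⟩

theorem Function.Periodic.map_nat_mul_add {g : ℝ → ℝ} {T : ℝ} (hg : Function.Periodic g T) (k : ℕ)
    (t : ℝ) : g (k * (t + T)) = g (k * t) := by
  rw [mul_add]
  exact hg.nat_mul k (k * t)

/-- A periodic function of zero mean has a periodic primitive of zero mean. -/
theorem exists_periodic_primitive {T : ℝ} (hT : 0 < T) {g : ℝ → ℝ} (hg : Continuous g)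
    (hper : Function.Periodic g T) (hint : ∫ t in (0 : ℝ)..T, g t = 0) :
    ∃ G : ℝ → ℝ, Function.Periodic G T ∧ (∀ t, HasDerivAt G (g t) t) ∧
      ∫ t in (0 : ℝ)..T, G t = 0 := by
  set P : ℝ → ℝ := fun t => ∫ s in (0 : ℝ)..t, g s with hP
  have hPd : ∀ t, HasDerivAt P (g t) t := fun t =>
    intervalIntegral.integral_hasDerivAt_right (hg.intervalIntegrable 0 t)
      (hg.stronglyMeasurableAtFilter _ _) hg.continuousAt
  have hPc : Continuous P := continuous_iff_continuousAt.2 fun t => (hPd t).continuousAt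
  refine ⟨fun t => P t - (∫ s in (0 : ℝ)..T, P s) / T, fun t => ?_,
    fun t => (hPd t).sub_const _, ?_⟩
  · simp only [hP]
    rw [← intervalIntegral.integral_add_adjacent_intervals (hg.intervalIntegrable 0 t)
      (hg.intervalIntegrable t (t + T)), hper.intervalIntegral_add_eq t 0, zero_add, hint,
      add_zero]
  · rw [intervalIntegral.integral_sub (hPc.intervalIntegrable _ _) (by simp)]
    simp [mul_div_cancel_left₀ _ hT.ne']

theorem exists_uniform_margin {T : ℝ} (hT : 0 < T) {h : ℝ → ℝ → ℝ → ℝ}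
    (hcont : Continuous (fun z : ℝ × ℝ × ℝ => h z.1 z.2.1 z.2.2))
    (hper : ∀ a b, Function.Periodic (h a b) T) {q₀ p₀ m : ℝ} (hlt : ∀ t, h q₀ p₀ t < m) :
    ∃ δ > 0, ∀ q p t, |q - q₀| < δ → |p - p₀| < δ → h q p t ≤ m - δ := by
  obtain ⟨t₀, ht₀⟩ := exists_forall_le_of_periodic hT
    (hcont.comp (by fun_prop : Continuous fun t : ℝ => (q₀, p₀, t))) (hper q₀ p₀)
  obtain ⟨m', hm', hmm⟩ := exists_between (hlt t₀)
  have hev : ∀ᶠ x : ℝ × ℝ in nhds (q₀, p₀), ∀ t ∈ Set.Icc 0 T, h x.1 x.2 t < m' := by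
    refine isCompact_Icc.eventually_forall_of_forall_eventually fun t _ => ?_
    have hc : Continuous fun z : (ℝ × ℝ) × ℝ => h z.1.1 z.1.2 z.2 :=
      hcont.comp (by fun_prop : Continuous fun z : (ℝ × ℝ) × ℝ => (z.1.1, z.1.2, z.2))
    exact hc.continuousAt.eventually (gt_mem_nhds ((ht₀ t).trans_lt hm'))
  obtain ⟨ε, hε, hball⟩ := Metric.eventually_nhds_iff.1 hev
  refine ⟨min ε (m - m'), lt_min hε (sub_pos.2 hmm), fun q p t hq hp => ?_⟩
  obtain ⟨s, hs, hts⟩ := (hper q p).exists_mem_Ico₀ hT t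
  have h1 : h q p s < m' := hball (y := (q, p))
    (max_lt (hq.trans_le (min_le_left _ _)) (hp.trans_le (min_le_left _ _))) s ⟨hs.1, hs.2.le⟩
  rw [hts]
  linarith [min_le_right ε (m - m')]

/-- For fast vibration, there is a periodic lower solution slightly above the horizontal
position `π / 2`. -/
theorem exists_lower_solution {T μ : ℝ} (hT : 0 < T) (hμ : 0 ≤ μ) {φ : ℝ → ℝ}
    (hφ : ContDiff ℝ 1 φ) (hφper : Function.Periodic φ T)
    (hφavg : ∫ τ in (0 : ℝ)..T, φ τ = 0) {h : ℝ → ℝ → ℝ → ℝ}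
    (hcont : Continuous (fun z : ℝ × ℝ × ℝ => h z.1 z.2.1 z.2.2))
    (hper : ∀ a b, Function.Periodic (h a b) T) (hlt : ∀ t, h (π / 2) 0 t < 1) :
    ∃ K : ℕ, ∀ k : ℕ, K < k → ∃ α : ℝ → ℝ, ContDiff ℝ 2 α ∧ Function.Periodic α T ∧
      (∀ t, π / 2 < α t ∧ α t < π) ∧
      ∀ t, -μ * deriv α t + (-(1 + k * deriv φ (k * t)) * sin (α t) +
        h (α t) (deriv α t + φ (k * t) * sin (α t)) t) ≤ deriv (deriv α) t := by
  obtain ⟨Φ, hΦper, hΦ, hΦavg⟩ := exists_periodic_primitive hT hφ.continuous hφper hφavg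
  have hΦc : Continuous Φ := continuous_iff_continuousAt.2 fun t => (hΦ t).continuousAt
  obtain ⟨X, hXper, hX, -⟩ := exists_periodic_primitive hT hΦc hΦper hΦavg
  have hXc : Continuous X := continuous_iff_continuousAt.2 fun t => (hX t).continuousAt
  obtain ⟨δ, hδ, hmargin⟩ := exists_uniform_margin hT hcont hper hlt
  obtain ⟨A₀, hA₀, hφA⟩ := exists_abs_le_of_periodic hT hφ.continuous hφper
  obtain ⟨A₁, hA₁, hφ'A⟩ := exists_abs_le_of_periodic hT hφ.continuous_deriv_one hφper.deriv
  obtain ⟨F, hF, hΦF⟩ := exists_abs_le_of_periodic hT hΦc hΦper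
  obtain ⟨Y, hY, hXY⟩ := exists_abs_le_of_periodic hT hXc hXper
  set c := F + μ * Y + 1 with hc
  have hc0 : 0 < c := by positivity
  set D := 2 * c + (A₀ + A₁ + 1) * (2 * c ^ 2) + (μ + μ ^ 2) * F with hD
  obtain ⟨K, hK⟩ := exists_nat_gt (max (D / δ) D)
  refine ⟨K, fun k hk => ?_⟩
  have hKk : (K : ℝ) < k := by exact_mod_cast hk
  have hk1 : (1 : ℝ) ≤ k := by exact_mod_cast (Nat.zero_le K).trans_lt hk
  have hk0 : (0 : ℝ) < k := by linarith
  set e : ℝ := 1 / k with he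
  have he0 : 0 < e := by positivity
  have he1 : e ≤ 1 := (div_le_one hk0).2 hk1
  have hke : k * e = 1 := by rw [he]; field_simp
  have hDδ : D * e < δ := by
    have := ((le_max_left _ _).trans_lt hK).trans hKk
    rw [div_lt_iff₀ hδ] at this
    rw [he, mul_one_div, div_lt_iff₀ hk0]
    linarith
  have hD1 : D * e < 1 := by
    rw [he, mul_one_div, div_lt_iff₀ hk0]
    linarith [((le_max_right _ _).trans_lt hK).trans hKk]
  set α : ℝ → ℝ := fun t => π / 2 + (c - Φ (k * t) + μ * e * X (k * t)) * e with hα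
  have hlin : ∀ t : ℝ, HasDerivAt (fun t : ℝ => k * t) k t := fun t => by
    simpa using (hasDerivAt_id t).const_mul (k : ℝ)
  have hα1 : ∀ t, HasDerivAt α (-φ (k * t) + μ * e * Φ (k * t)) t := fun t => by
    have := ((((hΦ (k * t)).comp t (hlin t)).const_sub c).add
      (((hX (k * t)).comp t (hlin t)).const_mul (μ * e))).mul_const e |>.const_add (π / 2)
    refine this.congr_deriv ?_
    linear_combination (-φ (k * t) + μ * e * Φ (k * t)) * hke
  have hφd : ∀ t, HasDerivAt φ (deriv φ t) t := fun t =>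
    (hφ.differentiable one_ne_zero t).hasDerivAt
  have hderiv : deriv α = fun t => -φ (k * t) + μ * e * Φ (k * t) := funext fun t => (hα1 t).deriv
  have hα2 : ∀ t, HasDerivAt (deriv α) (-k * deriv φ (k * t) + μ * φ (k * t)) t := fun t => by
    have := (((hφd (k * t)).comp t (hlin t)).neg).add
      (((hΦ (k * t)).comp t (hlin t)).const_mul (μ * e))
    rw [hderiv]
    refine this.congr_deriv ?_
    linear_combination (μ * φ (k * t)) * hke
  have hbound : ∀ t, e ≤ α t - π / 2 ∧ α t - π / 2 ≤ 2 * c * e := fun t => by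
    have h1 := abs_le.1 (hΦF (k * t))
    have h2 : |μ * e * X (k * t)| ≤ μ * Y := by
      rw [abs_mul, abs_of_nonneg (by positivity)]
      refine mul_le_mul ?_ (hXY _) (abs_nonneg _) hμ
      exact mul_le_of_le_one_right hμ he1
    rw [abs_le] at h2
    simp only [hα, add_sub_cancel_left]
    constructor
    · exact le_mul_of_one_le_left he0.le (by linarith)
    · exact mul_le_mul_of_nonneg_right (by linarith) he0.le
  have hD2 : 2 * c ≤ D := by
    have : 0 ≤ (A₀ + A₁ + 1) * (2 * c ^ 2) + (μ + μ ^ 2) * F := by positivity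
    linarith
  have hpi := Real.pi_gt_three
  refine ⟨α, ?_, fun t => ?_, fun t => ⟨by linarith [(hbound t).1], ?_⟩, fun t => ?_⟩
  · have hΦ1 : ContDiff ℝ 1 Φ := contDiff_one_iff_deriv.2
      ⟨fun t => (hΦ t).differentiableAt, by
        rw [show deriv Φ = φ from funext fun t => (hΦ t).deriv]; exact hφ.continuous⟩
    refine (contDiff_succ_iff_deriv (n := 1)).2
      ⟨fun t => (hα1 t).differentiableAt, by simp, ?_⟩
    rw [hderiv]
    fun_prop
  · simp only [hα, hΦper.map_nat_mul_add k t, hXper.map_nat_mul_add k t]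
  · have := mul_le_mul_of_nonneg_right hD2 he0.le
    linarith [(hbound t).2]
  set s := 1 - sin (α t) with hs
  have hs0 : 0 ≤ s := sub_nonneg.2 (sin_le_one _)
  have hs1 : s ≤ 2 * c ^ 2 * (e * e) := by
    have h1 := Real.one_sub_sq_div_two_le_cos (x := α t - π / 2)
    rw [cos_sub_pi_div_two] at h1
    have h2 := mul_self_le_mul_self (he0.le.trans (hbound t).1) (hbound t).2
    linarith
  have hs2 : s ≤ 2 * c ^ 2 * e :=
    hs1.trans (mul_le_mul_of_nonneg_left (mul_le_of_le_one_left he0.le he1) (by positivity))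
  have hks : k * s ≤ 2 * c ^ 2 * e := by
    have := mul_le_mul_of_nonneg_left hs1 hk0.le
    calc k * s ≤ 2 * c ^ 2 * e * (k * e) := by linarith
      _ = 2 * c ^ 2 * e := by rw [hke, mul_one]
  have hE : ∀ {a b u v : ℝ}, |a| ≤ b → 0 ≤ u → u ≤ v → |a * u| ≤ b * v := fun h1 h2 h3 => by
    rw [abs_mul, abs_of_nonneg h2]
    exact mul_le_mul h1 h3 h2 ((abs_nonneg _).trans h1)
  have b1 := abs_le.1 (hE (hφA (k * t)) hs0 hs2)
  have b2 := abs_le.1 (hE (hφ'A (k * t)) (by positivity) hks)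
  have b3 := abs_le.1 (hE (hΦF (k * t)) (by positivity : 0 ≤ μ * e) le_rfl)
  have b4 := abs_le.1 (hE (hΦF (k * t)) (by positivity : 0 ≤ μ ^ 2 * e) le_rfl)
  have n0 : 0 ≤ c * e := by positivity
  have n1 : 0 ≤ A₀ * (2 * c ^ 2 * e) := by positivity
  have n2 : 0 ≤ A₁ * (2 * c ^ 2 * e) := by positivity
  have n3 : 0 ≤ F * (μ * e) := by positivity
  have n4 : 0 ≤ F * (μ ^ 2 * e) := by positivity
  have n5 : 0 ≤ 2 * c ^ 2 * e := by positivity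
  have hDe : D * e = 2 * (c * e) + A₀ * (2 * c ^ 2 * e) + A₁ * (2 * c ^ 2 * e) + 2 * c ^ 2 * e +
      F * (μ * e) + F * (μ ^ 2 * e) := by rw [hD]; ring
  rw [(hα2 t).deriv, hderiv]
  have hsin : sin (α t) = 1 - s := by rw [hs]; ring
  rw [show -φ (k * t) + μ * e * Φ (k * t) + φ (k * t) * sin (α t)
    = Φ (k * t) * (μ * e) - φ (k * t) * s by rw [hsin]; ring]
  have hh := hmargin (α t) (Φ (k * t) * (μ * e) - φ (k * t) * s) t
    (abs_lt.2 ⟨by linarith [(hbound t).1], by linarith [(hbound t).2]⟩)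
    (by rw [sub_zero]; exact abs_lt.2 ⟨by linarith, by linarith⟩)
  rw [hsin]
  linarith

theorem contDiff_infty_of_ode {E : Type*} [NormedAddCommGroup E] [NormedSpace ℝ E]
    {f : ℝ × E → E} (hf : ContDiff ℝ (⊤ : ℕ∞) f) {x : ℝ → E}
    (hx : ∀ t, HasDerivAt x (f (t, x t)) t) : ContDiff ℝ (⊤ : ℕ∞) x := by
  rw [contDiff_infty]
  intro n
  induction n with
  | zero => exact contDiff_zero.2 (continuous_iff_continuousAt.2 fun t => (hx t).continuousAt)
  | succ n ih =>
    push_cast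
    refine (contDiff_succ_iff_deriv (n := n)).2 ⟨fun t => (hx t).differentiableAt, by simp, ?_⟩
    rw [show deriv x = fun t => f (t, x t) from funext fun t => (hx t).deriv]
    exact (contDiff_infty.1 hf n).comp (contDiff_id.prodMk ih)

/-- **Theorem 2.1** (Kapitza–Whitney pendulum, existence of a periodic solution
without falls). If `φ` is smooth, `T`-periodic with zero average, and the
horizontal force `h` is smooth, bounded, `T`-periodic in time and satisfies
`h(π/2,0,t) < 1`, `h(3π/2,0,t) > -1`, then for all sufficiently large `k` the
system admits a `T`-periodic solution with `q(t) ∈ (π/2, 3π/2)` for all `t`. -/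
theorem kapitza_whitney_periodic_solution_without_falls
    (T μ : ℝ) (hT : 0 < T) (hμ : 0 ≤ μ)
    (φ : ℝ → ℝ) (hφsmooth : ContDiff ℝ (⊤ : ℕ∞) φ)
    (hφper : Function.Periodic φ T)
    (hφavg : ∫ τ in (0:ℝ)..T, φ τ = 0)
    (h : ℝ → ℝ → ℝ → ℝ)
    (hsmooth : ContDiff ℝ (⊤ : ℕ∞) (fun x : ℝ × ℝ × ℝ => h x.1 x.2.1 x.2.2))
    (hbdd : ∃ C : ℝ, ∀ a b t : ℝ, |h a b t| ≤ C)
    (hper : ∀ a b : ℝ, Function.Periodic (h a b) T)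
    (hleft : ∀ t : ℝ, h (π / 2) 0 t < 1)
    (hright : ∀ t : ℝ, h (3 * π / 2) 0 t > -1) :
    ∃ K : ℕ, ∀ k : ℕ, k > K →
      ∃ q p : ℝ → ℝ,
        ContDiff ℝ (⊤ : ℕ∞) q ∧ ContDiff ℝ (⊤ : ℕ∞) p ∧
        Function.Periodic q T ∧ Function.Periodic p T ∧
        (∀ t : ℝ, deriv q t = p t - φ (k * t) * sin (q t)) ∧
        (∀ t : ℝ, deriv p t =
          -μ * p t + (μ * sin (q t) + p t * cos (q t)) * φ (k * t)
            - sin (q t) - (φ (k * t)) ^ 2 / 2 * sin (2 * q t)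
            + h (q t) (p t) t) ∧
        (∀ t : ℝ, q t ∈ Set.Ioo (π / 2) (3 * π / 2)) := by
  obtain ⟨C, hC⟩ := hbdd
  obtain ⟨A₁, hA₁, hφ'A⟩ := exists_abs_le_of_periodic hT
    (hφsmooth.continuous_deriv (by simp)) hφper.deriv
  have hφ1 : ContDiff ℝ 1 φ := hφsmooth.of_le (by simp)
  obtain ⟨K₁, hK₁⟩ := exists_lower_solution hT hμ hφ1 hφper hφavg hsmooth.continuous hper hleft
  obtain ⟨K₂, hK₂⟩ := exists_lower_solution (h := fun q p t => -h (2 * π - q) (-p) t)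
    hT hμ hφ1 hφper hφavg
    (hsmooth.continuous.comp (by fun_prop :
      Continuous fun z : ℝ × ℝ × ℝ => (2 * π - z.1, -z.2.1, z.2.2))).neg
    (fun a b t => by simp only [hper (2 * π - a) (-b) t])
    (fun t => by
      rw [show 2 * π - π / 2 = 3 * π / 2 by ring, neg_zero]
      linarith [hright t])
  refine ⟨max K₁ K₂, fun k hk => ?_⟩
  obtain ⟨α, hα, hαper, hαm, hαlow⟩ := hK₁ k ((le_max_left _ _).trans_lt hk)
  obtain ⟨γ, hγ, hγper, hγm, hγlow⟩ := hK₂ k ((le_max_right _ _).trans_lt hk)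
  have hφ' : ContDiff ℝ (⊤ : ℕ∞) (deriv φ) := (contDiff_infty_iff_deriv.1 hφsmooth).2
  set B : ℝ → ℝ → ℝ → ℝ := fun t q v =>
    -(1 + k * deriv φ (k * t)) * sin q + h q (v + φ (k * t) * sin q) t with hB
  have hBsmooth : ContDiff ℝ (⊤ : ℕ∞) (fun z : ℝ × ℝ × ℝ => B z.1 z.2.1 z.2.2) := by
    have h1 : ContDiff ℝ (⊤ : ℕ∞) (fun z : ℝ × ℝ × ℝ => φ (k * z.1)) :=
      hφsmooth.comp (by fun_prop)
    have h2 : ContDiff ℝ (⊤ : ℕ∞) (fun z : ℝ × ℝ × ℝ => deriv φ (k * z.1)) :=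
      hφ'.comp (by fun_prop)
    have h3 : ContDiff ℝ (⊤ : ℕ∞) (fun z : ℝ × ℝ × ℝ =>
        h z.2.1 (z.2.2 + φ (k * z.1) * sin z.2.1) z.1) :=
      hsmooth.comp (g := fun x : ℝ × ℝ × ℝ => h x.1 x.2.1 x.2.2)
        (f := fun z : ℝ × ℝ × ℝ => (z.2.1, z.2.2 + φ (k * z.1) * sin z.2.1, z.1)) (by fun_prop)
    simp only [hB]
    fun_prop
  have hβ1 : deriv (fun t => 2 * π - γ t) = fun t => -deriv γ t :=
    funext fun t => deriv_const_sub _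
  have hβ2 : deriv (fun t => -deriv γ t) = fun t => -deriv (deriv γ) t :=
    funext fun t => deriv.fun_neg
  obtain ⟨q, v, hqper, hvper, hq, hv, hm⟩ := exists_periodic_between_lower_upper hT hμ (B := B)
    (A := 1 + k * A₁ + C) (β := fun t => 2 * π - γ t) (hBsmooth.of_le (by simp))
    (fun t q v => by
      simp only [hB]
      rw [hper, hφper.map_nat_mul_add k t, hφper.deriv.map_nat_mul_add k t])
    (fun t q v => by
      refine (abs_add_le _ _).trans (add_le_add ?_ (hC _ _ _))
      rw [abs_mul, abs_neg]
      refine (mul_le_of_le_one_right (abs_nonneg _) (abs_sin_le_one _)).trans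
        ((abs_add_le _ _).trans ?_)
      rw [abs_one, abs_mul, Nat.abs_cast]
      exact add_le_add le_rfl (mul_le_mul_of_nonneg_left (hφ'A _) k.cast_nonneg))
    hα (contDiff_const.sub hγ) hαper (fun t => by simp only [hγper t])
    (fun t => by linarith [(hαm t).2, (hγm t).2]) hαlow
    (fun t => by
      have := hγlow t
      rw [hβ1, hβ2]
      simp only [hB, sin_two_pi_sub]
      rw [show -deriv γ t + φ (k * t) * -sin (γ t) = -(deriv γ t + φ (k * t) * sin (γ t)) by ring]
      linarith)
  have hqv : ContDiff ℝ (⊤ : ℕ∞) (fun t => (q t, v t)) := by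
    refine contDiff_infty_of_ode
      (f := fun z : ℝ × ℝ × ℝ => (z.2.2, -μ * z.2.2 + B z.1 z.2.1 z.2.2)) (by fun_prop)
      fun t => (hq t).prodMk (hv t)
  have hlin : ∀ t : ℝ, HasDerivAt (fun t : ℝ => k * t) k t := fun t => by
    simpa using (hasDerivAt_id t).const_mul (k : ℝ)
  have hφk : ∀ t, HasDerivAt (fun t => φ (k * t)) (deriv φ (k * t) * k) t := fun t =>
    ((hφ1.differentiable one_ne_zero _).hasDerivAt).comp t (hlin t)
  have hqs : ContDiff ℝ (⊤ : ℕ∞) q := hqv.fst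
  have hφks : ContDiff ℝ (⊤ : ℕ∞) (fun t => φ (k * t)) := hφsmooth.comp (by fun_prop)
  refine ⟨q, fun t => v t + φ (k * t) * sin (q t), hqs, hqv.snd.add (hφks.mul hqs.sin), hqper,
    fun t => ?_, fun t => ?_, fun t => ?_, fun t => ⟨?_, ?_⟩⟩
  · simp only [hvper t, hqper t, hφper.map_nat_mul_add k t]
  · rw [(hq t).deriv]
    ring
  · refine ((hv t).add ((hφk t).mul (hq t).sin)).deriv.trans ?_
    rw [sin_two_mul]
    simp only [hB]
    ring
  · exact (hαm t).1.trans_le (hm t).1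
  · linarith [(hγm t).1, (hm t).2]
end

section
/- Let T > 0, μ ≥ 0, let φ : ℝ → ℝ be C^∞, T-periodic with zero average over its period, and set Φ = (1/T)·∫₀^T φ(τ)² dτ. Assume Φ > 1, let λ₂(Φ) = (−1 − √(1+8Φ²))/(4Φ), q_max² = arccos(λ₂(Φ)), q_min² = 2π − arccos(λ₂(Φ)), and f_Φ(q) = −sin q − (Φ/2)·sin(2q). Let h : ℝ × ℝ × ℝ → ℝ be C^∞, bounded, T-periodic in its last argument, and assume for all t ∈ ℝ: h(π/2, 0, t) < 1, h(3π/2, 0, t) > −1, h(q_max², 0, t) > −f_Φ(q_max²), and h(q_min², 0, t) < −f_Φ(q_min²). Then there exists K ∈ ℕ such that for every natural number k > K the system q̇ = p − φ(kt)·sin q, ṗ = −μp + (μ sin q + p cos q)·φ(kt) − sin q − (φ(kt)²/2)·sin 2q + h(q, p, t) admits two distinct T-periodic C^∞ solutions (q₁, p₁) and (q₂, p₂) with q₁(t) ∈ (π/2, q_max²) and q₂(t) ∈ (q_min², 3π/2) for all t ∈ ℝ. -/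
open Real

/-- A continuous angle along a segment whose cosine, after a shift by `s`, stays positive
remains in a single arc of length `π`. -/
lemma exists_int_abs_sub_lt_of_cos_pos {a b : ℝ} (hab : a ≤ b) {u : ℝ → ℝ} (hu : Continuous u)
    (s : ℝ) (hcos : ∀ t ∈ Set.Icc a b, 0 < cos (u t - s)) :
    ∃ n : ℤ, ∀ t ∈ Set.Icc a b, |u t - s - 2 * π * n| < π / 2 := by
  have hpi := pi_pos
  set n : ℤ := round ((u a - s) / (2 * π)) with hn
  set v : ℝ → ℝ := fun t => |u t - s - 2 * π * n| with hv
  have hvc : Continuous v := by fun_prop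
  have hcosv : ∀ t ∈ Set.Icc a b, 0 < cos (v t) := by
    intro t ht
    have h := hcos t ht
    rwa [hv, cos_abs, show u t - s - 2 * π * n = u t - s - n * (2 * π) by ring,
      cos_sub_int_mul_two_pi]
  have hne : ∀ t ∈ Set.Icc a b, v t ≠ π / 2 := by
    intro t ht h
    have := hcosv t ht
    rw [h, cos_pi_div_two] at this
    exact lt_irrefl _ this
  have hva : v a < π / 2 := by
    have h1 : v a ≤ π := by
      have h := abs_sub_round ((u a - s) / (2 * π))
      rw [← hn] at h
      have h2 : v a = |(u a - s) / (2 * π) - n| * (2 * π) := by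
        rw [← abs_of_pos (show 0 < 2 * π by positivity), ← abs_mul,
          abs_of_pos (show 0 < 2 * π by positivity)]
        simp only [hv]
        congr 1
        field_simp
      rw [h2]
      nlinarith
    by_contra! hcon
    have := hcosv a ⟨le_rfl, hab⟩
    have := cos_nonpos_of_pi_div_two_le_of_le hcon (by linarith)
    linarith
  refine ⟨n, fun t ht => ?_⟩
  by_contra! hcon
  obtain ⟨r, hr, hr'⟩ := intermediate_value_Icc ht.1 hvc.continuousOn ⟨hva.le, hcon⟩
  exact hne r ⟨hr.1, hr.2.trans ht.2⟩ hr'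

/-- The **Poincaré–Miranda theorem** on a rectangle. -/
theorem poincare_miranda {a₁ b₁ a₂ b₂ : ℝ} (h₁ : a₁ ≤ b₁) (h₂ : a₂ ≤ b₂)
    {F : ℝ × ℝ → ℝ × ℝ} (hF : Continuous F)
    (hleft : ∀ y ∈ Set.Icc a₂ b₂, (F (a₁, y)).2 < 0)
    (hright : ∀ y ∈ Set.Icc a₂ b₂, 0 < (F (b₁, y)).2)
    (hbot : ∀ x ∈ Set.Icc a₁ b₁, (F (x, a₂)).1 < 0)
    (htop : ∀ x ∈ Set.Icc a₁ b₁, 0 < (F (x, b₂)).1) :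
    ∃ z ∈ Set.Icc a₁ b₁ ×ˢ Set.Icc a₂ b₂, F z = 0 := by
  by_contra! hcon
  have hpi := pi_pos
  set c : ℝ × ℝ → ℝ × ℝ := fun z => (max a₁ (min b₁ z.1), max a₂ (min b₂ z.2)) with hc
  have hcmem : ∀ z, c z ∈ Set.Icc a₁ b₁ ×ˢ Set.Icc a₂ b₂ := fun z => by
    simp [hc, h₁, h₂]
  have hcid : ∀ x ∈ Set.Icc a₁ b₁, ∀ y ∈ Set.Icc a₂ b₂, c (x, y) = (x, y) := by
    rintro x ⟨hx, hx'⟩ y ⟨hy, hy'⟩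
    simp [*]
  set g : ℝ × ℝ → ℂ := fun z => ((F (c z)).2 : ℂ) + (F (c z)).1 * Complex.I with hg
  have hgc : Continuous g := by fun_prop
  have hre : ∀ z, (g z).re = (F (c z)).2 := fun z => by simp [hg]
  have him : ∀ z, (g z).im = (F (c z)).1 := fun z => by simp [hg]
  have hg0 : ∀ z, g z ≠ 0 := by
    intro z hz
    refine hcon (c z) (hcmem z) (Prod.ext ?_ ?_)
    · rw [← him, hz]; rfl
    · rw [← hre, hz]; rfl
  have hsc : IsSimplyConnected (Set.univ : Set (ℝ × ℝ)) := by
    have : SimplyConnectedSpace (ℝ × ℝ) := inferInstance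
    exact (Homeomorph.Set.univ (ℝ × ℝ)).toHomotopyEquiv.simplyConnectedSpace
  obtain ⟨L, hLc, hL⟩ := Complex.exists_continuousOn_eqOn_exp_comp hsc isOpen_univ
    hgc.continuousOn (by rintro ⟨z, -, hz⟩; exact hg0 z hz)
  rw [continuousOn_univ] at hLc
  have hcosL : ∀ z, (F (c z)).2 = exp (L z).re * cos (L z).im := fun z => by
    rw [← hre, ← hL (Set.mem_univ z)]; exact Complex.exp_re _
  have hsinL : ∀ z, (F (c z)).1 = exp (L z).re * sin (L z).im := fun z => by
    rw [← him, ← hL (Set.mem_univ z)]; exact Complex.exp_im _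
  obtain ⟨n₁, hn₁⟩ := exists_int_abs_sub_lt_of_cos_pos h₂
    (u := fun y => (L (b₁, y)).im) (by fun_prop) 0 fun y hy => by
      have := hright y hy
      rw [← hcid _ ⟨h₁, le_rfl⟩ _ hy, hcosL] at this
      simpa using pos_of_mul_pos_right this (exp_pos _).le
  obtain ⟨n₂, hn₂⟩ := exists_int_abs_sub_lt_of_cos_pos h₁
    (u := fun x => (L (x, b₂)).im) (by fun_prop) (π / 2) fun x hx => by
      have := htop x hx
      rw [← hcid _ hx _ ⟨h₂, le_rfl⟩, hsinL] at this
      rw [cos_sub_pi_div_two]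
      exact pos_of_mul_pos_right this (exp_pos _).le
  obtain ⟨n₃, hn₃⟩ := exists_int_abs_sub_lt_of_cos_pos h₂
    (u := fun y => (L (a₁, y)).im) (by fun_prop) π fun y hy => by
      have := hleft y hy
      rw [← hcid _ ⟨le_rfl, h₁⟩ _ hy, hcosL] at this
      rw [cos_sub_pi]
      have := exp_pos (L (a₁, y)).re
      by_contra!
      nlinarith
  obtain ⟨n₄, hn₄⟩ := exists_int_abs_sub_lt_of_cos_pos h₁
    (u := fun x => (L (x, a₂)).im) (by fun_prop) (3 * π / 2) fun x hx => by
      have := hbot x hx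
      rw [← hcid _ hx _ ⟨le_rfl, h₂⟩, hsinL] at this
      rw [show (L (x, a₂)).im - 3 * π / 2 = (L (x, a₂)).im - π / 2 - π by ring, cos_sub_pi,
        cos_sub_pi_div_two]
      have := exp_pos (L (x, a₂)).re
      by_contra!
      nlinarith
  have e₁ := hn₁ b₂ ⟨h₂, le_rfl⟩
  have e₂ := hn₂ b₁ ⟨h₁, le_rfl⟩
  have e₃ := hn₂ a₁ ⟨le_rfl, h₁⟩
  have e₄ := hn₃ b₂ ⟨h₂, le_rfl⟩
  have e₅ := hn₃ a₂ ⟨le_rfl, h₂⟩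
  have e₆ := hn₄ a₁ ⟨le_rfl, h₁⟩
  have e₇ := hn₄ b₁ ⟨h₁, le_rfl⟩
  have e₈ := hn₁ a₂ ⟨le_rfl, h₂⟩
  simp only [abs_lt] at e₁ e₂ e₃ e₄ e₅ e₆ e₇ e₈
  have aux : ∀ (m n : ℤ) (r : ℝ), π * (2 * (m - n)) < π * r → (2 * (m - n) : ℝ) < r :=
    fun m n r h => lt_of_mul_lt_mul_left h hpi.le
  have k₁ := aux n₁ n₂ 2 (by linarith)
  have k₂ := aux n₂ n₃ 2 (by linarith)
  have k₃ := aux n₃ n₄ 2 (by linarith)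
  have k₄ := aux n₄ n₁ 0 (by linarith)
  have k₅ := aux n₂ n₁ 1 (by linarith)
  have k₆ := aux n₃ n₂ 1 (by linarith)
  have k₇ := aux n₄ n₃ 1 (by linarith)
  norm_cast at k₁ k₂ k₃ k₄ k₅ k₆ k₇
  omega

section ODE

variable {E : Type*} [NormedAddCommGroup E] [NormedSpace ℝ E]

/-- A bounded, globally Lipschitz, time-dependent vector field has global integral curves. -/
theorem exists_isIntegralCurve_of_lipschitzWith [CompleteSpace E] {v : ℝ → E → E} {K : NNReal}
    (hlip : ∀ t, LipschitzWith K (v t)) (hcont : ∀ x, Continuous fun t => v t x)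
    {N : ℝ} (hbdd : ∀ t x, ‖v t x‖ ≤ N) (x₀ : E) :
    ∃ X : ℝ → E, X 0 = x₀ ∧ IsIntegralCurve X v := by
  have hN : 0 ≤ N := (norm_nonneg _).trans (hbdd 0 x₀)
  have key : ∀ n : ℕ, ∃ X : ℝ → E, X 0 = x₀ ∧
      ∀ t ∈ Set.Ioo (-(n + 1 : ℝ)) (n + 1), HasDerivAt X (v t (X t)) t := by
    intro n
    have h0 : (0 : ℝ) ∈ Set.Icc (-(n + 1 : ℝ)) (n + 1) := by
      constructor <;> linarith [(Nat.cast_nonneg n : (0 : ℝ) ≤ n)]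
    have hPL : IsPicardLindelof v (⟨0, h0⟩ : Set.Icc (-(n + 1 : ℝ)) (n + 1)) x₀
        (N.toNNReal * (n + 1)) 0 N.toNNReal K :=
      { lipschitzOnWith := fun t _ => (hlip t).lipschitzOnWith
        continuousOn := fun x _ => (hcont x).continuousOn
        norm_le := fun t _ x _ => by simpa [hN] using hbdd t x
        mul_max_le := by simp }
    obtain ⟨X, hX0, hX⟩ := hPL.exists_eq_forall_mem_Icc_hasDerivWithinAt₀
    exact ⟨X, hX0, fun t ht => (hX t ⟨ht.1.le, ht.2.le⟩).hasDerivAt (Icc_mem_nhds ht.1 ht.2)⟩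
  choose X hX0 hX using key
  have hagree : ∀ m n : ℕ, m ≤ n → ∀ t ∈ Set.Ioo (-(m + 1 : ℝ)) (m + 1), X m t = X n t := by
    intro m n hmn
    have hmn' : (m : ℝ) ≤ n := by exact_mod_cast hmn
    have h0 : (0 : ℝ) ∈ Set.Ioo (-(m + 1 : ℝ)) (m + 1) := by
      constructor <;> linarith [(Nat.cast_nonneg m : (0 : ℝ) ≤ m)]
    exact ODE_solution_unique_of_mem_Ioo (s := fun _ => Set.univ)
      (fun t _ => (hlip t).lipschitzOnWith) h0
      (fun t ht => ⟨hX m t ht, trivial⟩)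
      (fun t ht => ⟨hX n t ⟨by linarith [ht.1], by linarith [ht.2]⟩, trivial⟩)
      ((hX0 m).trans (hX0 n).symm)
  refine ⟨fun t => X ⌈|t|⌉₊ t, by simpa using hX0 _, fun t => ?_⟩
  set n : ℕ := ⌈|t|⌉₊ + 1 with hn
  have hmem : ∀ s : ℝ, s ∈ Set.Ioo (-(⌈|s|⌉₊ + 1 : ℝ)) (⌈|s|⌉₊ + 1) := by
    intro s
    have h1 := Nat.le_ceil |s|
    have h2 := abs_le.1 h1
    constructor <;> linarith
  have hev : ∀ᶠ s in nhds t, X ⌈|s|⌉₊ s = X n s := by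
    have : ∀ᶠ s in nhds t, |s| < |t| + 1 :=
      (continuous_abs.tendsto t).eventually_lt_const (lt_add_one _)
    filter_upwards [this] with s hs
    refine hagree _ _ (Nat.ceil_le.2 ?_) s (hmem s)
    rw [hn]; push_cast
    linarith [Nat.le_ceil |t|]
  have hd : HasDerivAt (X n) (v t (X n t)) t :=
    hX n t (by have := hmem t; rw [hn]; push_cast; constructor <;> linarith [this.1, this.2])
  have ht := hev.self_of_nhds
  dsimp only
  rw [ht]
  exact hd.congr_of_eventuallyEq hev

lemma IsIntegralCurve.eq_of_apply_eq {v : ℝ → E → E} {K : NNReal}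
    (hlip : ∀ t, LipschitzWith K (v t)) {X Y : ℝ → E} (hX : IsIntegralCurve X v)
    (hY : IsIntegralCurve Y v) {t₀ : ℝ} (h : X t₀ = Y t₀) : X = Y :=
  ODE_solution_unique_univ (s := fun _ => Set.univ) (fun t => (hlip t).lipschitzOnWith)
    (fun t => ⟨hX t, trivial⟩) (fun t => ⟨hY t, trivial⟩) h

/-- An integral curve of a `T`-periodic vector field that returns after time `T` is periodic. -/
lemma IsIntegralCurve.periodic {v : ℝ → E → E} {K : NNReal} {T : ℝ}
    (hlip : ∀ t, LipschitzWith K (v t)) (hper : ∀ t x, v (t + T) x = v t x)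
    {X : ℝ → E} (hX : IsIntegralCurve X v) (h : X T = X 0) : Function.Periodic X T := by
  have hY : IsIntegralCurve (X ∘ (· + T)) v := by
    have h1 := hX.comp_add T
    have h2 : v ∘ (· + T) = v := by ext t x; exact hper t x
    rwa [h2] at h1
  exact fun t => congrFun (hY.eq_of_apply_eq hlip hX (t₀ := 0) (by simpa using h)) t

/-- First-order averaging: if `w` differs from `v` by oscillating terms `a i (k t) • g i x` whose
profiles `a i` have bounded primitives `A i`, then integral curves of `w` follow those of `v` up to
an error of order `1 / k`. -/
theorem exists_dist_le_of_oscillating {ι : Type*} [Fintype ι] {v : ℝ → E → E} {K : NNReal}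
    (hlip : ∀ t, LipschitzWith K (v t)) {N : ℝ}
    {a A : ι → ℝ → ℝ} {g : ι → E → E} {g' : ι → E → E →L[ℝ] E}
    (hA : ∀ i t, HasDerivAt (A i) (a i t) t) (hAb : ∀ i t, |A i t| ≤ N)
    (hg : ∀ i x, HasFDerivAt (g i) (g' i x) x) (hgb : ∀ i x, ‖g i x‖ ≤ N)
    (hgb' : ∀ i x, ‖g' i x‖ ≤ N)
    (hw : ∀ (k : ℕ) t x, ‖v t x + ∑ i, a i (k * t) • g i x‖ ≤ N) (T : ℝ) :
    ∃ C : ℝ, ∀ k : ℕ, 0 < k → ∀ X Y : ℝ → E,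
      IsIntegralCurve X (fun t x => v t x + ∑ i, a i (k * t) • g i x) → IsIntegralCurve Y v →
      ∀ t ∈ Set.Icc 0 T, dist (X t) (Y t) ≤ C * (dist (X 0) (Y 0) + 1 / k) := by
  set n : ℝ := (Fintype.card ι : ℝ) with hn
  set K' : NNReal := K + 1 with hK'
  have hKpos : (0 : ℝ) < K' := by rw [hK']; positivity
  have hlip' : ∀ t, LipschitzWith K' (v t) := fun t => (hlip t).weaken (by simp [hK'])
  have hN : 0 ≤ N := (norm_nonneg _).trans (hw 0 0 0)
  set D : ℝ := n * (N * N) with hD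
  have hD0 : 0 ≤ D := by positivity
  set B : ℝ := n * (N * (N * N)) + K' * D with hB
  have hB0 : 0 ≤ B := by positivity
  set G : ℝ := rexp (K' * T) with hG
  refine ⟨D + (1 + D) * G + B / K' * G + G, fun k hk X Y hX hY t ht => ?_⟩
  have hk' : (0 : ℝ) < k := by exact_mod_cast hk
  have hT : 0 ≤ T := ht.1.trans ht.2
  set U : ℝ → E := fun t => ∑ i, A i (k * t) • g i (X t) with hU
  have hUb : ∀ t, ‖U t‖ ≤ D := by
    intro t
    calc ‖U t‖ ≤ ∑ i, ‖A i (k * t) • g i (X t)‖ := norm_sum_le _ _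
      _ ≤ ∑ _i : ι, N * N := by
          gcongr with i
          rw [norm_smul]
          exact mul_le_mul (hAb i _) (hgb i _) (norm_nonneg _) hN
      _ = D := by simp [hD, hn]
  set X' : ℝ → E := fun t => v t (X t) + ∑ i, a i (k * t) • g i (X t) with hX'
  set R : ℝ → E := fun t => ∑ i, A i (k * t) • g' i (X t) (X' t) with hR
  have hRb : ∀ t, ‖R t‖ ≤ n * (N * (N * N)) := by
    intro t
    calc ‖R t‖ ≤ ∑ i, ‖A i (k * t) • g' i (X t) (X' t)‖ := norm_sum_le _ _
      _ ≤ ∑ _i : ι, N * (N * N) := by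
          gcongr with i
          rw [norm_smul]
          refine mul_le_mul (hAb i _) ?_ (norm_nonneg _) hN
          exact (ContinuousLinearMap.le_opNorm _ _).trans
            (mul_le_mul (hgb' i _) (hw k _ _) (norm_nonneg _) hN)
      _ = _ := by simp [hn]
  have hUd : ∀ t, HasDerivAt U ((k : ℝ) • (∑ i, a i (k * t) • g i (X t)) + R t) t := by
    intro t
    have h1 : HasDerivAt U (∑ i, (A i (k * t) • g' i (X t) (X' t)
        + (a i (k * t) * k) • g i (X t))) t := by
      refine HasDerivAt.fun_sum fun i _ => ?_
      have h2 : HasDerivAt (fun t => A i (k * t)) (a i (k * t) * k) t := by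
        have := (hA i (k * t)).comp t ((hasDerivAt_id t).const_mul (k : ℝ))
        simpa [Function.comp_def] using this
      exact h2.smul ((hg i (X t)).comp_hasDerivAt t (hX t))
    convert h1 using 1
    rw [Finset.sum_add_distrib, add_comm, Finset.smul_sum]
    congr 1
    refine Finset.sum_congr rfl fun i _ => ?_
    rw [smul_smul, mul_comm]
  set Z : ℝ → E := fun t => X t - (1 / k : ℝ) • U t with hZ
  have hZd : ∀ t, HasDerivAt Z (v t (X t) - (1 / k : ℝ) • R t) t := by
    intro t
    convert (hX t).fun_sub ((hUd t).fun_const_smul (1 / k : ℝ)) using 1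
    rw [smul_add, smul_smul, one_div_mul_cancel hk'.ne', one_smul]
    dsimp only
    abel
  have hXZ : ∀ t, dist (X t) (Z t) ≤ D * (1 / k) := by
    intro t
    rw [dist_eq_norm, hZ]
    simp only [sub_sub_cancel]
    rw [norm_smul, Real.norm_of_nonneg (by positivity), mul_comm]
    gcongr
    exact hUb t
  have hgron := dist_le_of_approx_trajectories_ODE (f := Z) (g := Y) (a := 0) (b := T)
    (εf := B * (1 / k)) (εg := 0) (δ := dist (X 0) (Y 0) + D * (1 / k)) hlip'
    (fun t _ => (hZd t).continuousAt.continuousWithinAt)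
    (fun t _ => (hZd t).hasDerivWithinAt)
    (fun t _ => by
      calc dist (v t (X t) - (1 / k : ℝ) • R t) (v t (Z t))
          ≤ dist (v t (X t) - (1 / k : ℝ) • R t) (v t (X t)) + dist (v t (X t)) (v t (Z t)) :=
            dist_triangle _ _ _
        _ ≤ n * (N * (N * N)) * (1 / k) + K' * (D * (1 / k)) := by
            refine add_le_add ?_ (((hlip' t).dist_le_mul _ _).trans ?_)
            · rw [dist_eq_norm, sub_sub_cancel_left, norm_neg, norm_smul,
                Real.norm_of_nonneg (by positivity), mul_comm]
              gcongr
              exact hRb t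
            · gcongr
              exact hXZ t
        _ = B * (1 / k) := by rw [hB]; ring)
    (fun t _ => (hY t).continuousAt.continuousWithinAt)
    (fun t _ => (hY t).hasDerivWithinAt)
    (fun t _ => by rw [dist_self])
    (by
      calc dist (Z 0) (Y 0) ≤ dist (Z 0) (X 0) + dist (X 0) (Y 0) := dist_triangle _ _ _
        _ ≤ dist (X 0) (Y 0) + D * (1 / k) := by
          rw [dist_comm (Z 0), add_comm]; gcongr; exact hXZ 0) t ht
  rw [gronwallBound_of_K_ne_0 hKpos.ne', add_zero, sub_zero] at hgron
  have hexp : rexp (K' * t) ≤ G := by rw [hG]; gcongr; exact ht.2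
  have hG0 : 0 < G := exp_pos _
  set d := dist (X 0) (Y 0) with hd
  have hd0 : 0 ≤ d := dist_nonneg
  set r : ℝ := 1 / k with hr
  have hr0 : 0 ≤ r := by positivity
  calc dist (X t) (Y t) ≤ dist (X t) (Z t) + dist (Z t) (Y t) := dist_triangle _ _ _
    _ ≤ D * r + ((d + D * r) * G + B * r / K' * G) := by
        refine add_le_add (hXZ t) (hgron.trans ?_)
        refine add_le_add ?_ ?_
        · gcongr
        · gcongr
          linarith
    _ ≤ (D + (1 + D) * G + B / K' * G + G) * (d + r) := by
        have e1 : 0 ≤ D * d := by positivity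
        have e2 : 0 ≤ D * G * d := by positivity
        have e3 : 0 ≤ B / K' * G * d := by positivity
        have e4 : 0 ≤ G * r := by positivity
        have e5 : 0 ≤ G * d := by positivity
        have e6 : B * r / K' * G = B / K' * G * r := by ring
        rw [e6]
        nlinarith

/-- Periodic solutions of the oscillating system starting in a compact set stay, for large
frequencies, in every open set that contains all the periodic solutions of the averaged one. -/
theorem exists_forall_periodic_mem_of_averaged [CompleteSpace E] {v : ℝ → E → E}
    {w : ℕ → ℝ → E → E} {K : NNReal} (hlip : ∀ t, LipschitzWith K (v t))
    (hcont : ∀ x, Continuous fun t => v t x) {N : ℝ} (hbdd : ∀ t x, ‖v t x‖ ≤ N)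
    {T : ℝ} (hT : 0 < T) (hper : ∀ t x, v (t + T) x = v t x)
    {C : ℝ} (hC : ∀ k : ℕ, 0 < k → ∀ X Y : ℝ → E, IsIntegralCurve X (w k) →
      IsIntegralCurve Y v → ∀ t ∈ Set.Icc 0 T, dist (X t) (Y t) ≤ C * (dist (X 0) (Y 0) + 1 / k))
    {S Ω : Set E} (hS : IsCompact S) (hΩ : IsOpen Ω)
    (hmem : ∀ Y, IsIntegralCurve Y v → Function.Periodic Y T → ∀ t, Y t ∈ Ω) :
    ∃ k₀ : ℕ, ∀ k : ℕ, k₀ < k → ∀ X, IsIntegralCurve X (w k) → Function.Periodic X T →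
      X 0 ∈ S → ∀ t, X t ∈ Ω := by
  by_contra! hcon
  choose k hk X hX hXper hXS s hs using hcon
  have hs' : ∀ n, ∃ t ∈ Set.Icc 0 T, X n t ∉ Ω := by
    intro n
    obtain ⟨t, ht, hst⟩ := (hXper n).exists_mem_Ico₀ hT (s n)
    exact ⟨t, ⟨ht.1, ht.2.le⟩, hst ▸ hs n⟩
  choose t ht htΩ using hs'
  obtain ⟨⟨x, τ⟩, ⟨hxS, hτ⟩, j, hj, hlim⟩ := (hS.prod isCompact_Icc).tendsto_subseq
    (x := fun n => (X n 0, t n)) (fun n => ⟨hXS n, ht n⟩)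
  obtain ⟨Y, hY0, hY⟩ := exists_isIntegralCurve_of_lipschitzWith hlip hcont hbdd x
  have hxlim : Filter.Tendsto (fun n => X (j n) 0) Filter.atTop (nhds x) :=
    (continuous_fst.tendsto _).comp hlim
  have htlim : Filter.Tendsto (fun n => t (j n)) Filter.atTop (nhds τ) :=
    (continuous_snd.tendsto _).comp hlim
  have hklim : Filter.Tendsto (fun n => (1 : ℝ) / k (j n)) Filter.atTop (nhds 0) := by
    have h1 : Filter.Tendsto (fun n => k (j n)) Filter.atTop Filter.atTop :=
      Filter.tendsto_atTop_mono (fun n => (hj.id_le n).trans (hk (j n)).le) Filter.tendsto_id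
    exact tendsto_one_div_atTop_nhds_zero_nat.comp h1
  have hEps : Filter.Tendsto (fun n => C * (dist (X (j n) 0) (Y 0) + 1 / k (j n)))
      Filter.atTop (nhds 0) := by
    have h1 := (hxlim.dist (tendsto_const_nhds (x := Y 0))).add hklim
    rw [hY0, dist_self, add_zero] at h1
    rw [hY0]
    simpa using h1.const_mul C
  have hest : ∀ n, ∀ r ∈ Set.Icc 0 T,
      dist (X (j n) r) (Y r) ≤ C * (dist (X (j n) 0) (Y 0) + 1 / k (j n)) := fun n r hr =>
    hC _ (Nat.pos_of_ne_zero (by have := hk (j n); omega)) _ _ (hX (j n)) hY r hr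
  have hYT : Y T = Y 0 := by
    have h1 : Filter.Tendsto (fun n => X (j n) T) Filter.atTop (nhds (Y T)) :=
      tendsto_iff_dist_tendsto_zero.2 (squeeze_zero (fun _ => dist_nonneg)
        (fun n => hest n T ⟨hT.le, le_rfl⟩) hEps)
    have h2 : (fun n => X (j n) T) = fun n => X (j n) 0 := by
      ext n; simpa using hXper (j n) 0
    rw [h2] at h1
    rw [hY0]
    exact tendsto_nhds_unique h1 hxlim
  have hYΩ := hmem Y hY (hY.periodic hlip hper hYT) τ
  have hlimτ : Filter.Tendsto (fun n => X (j n) (t (j n))) Filter.atTop (nhds (Y τ)) := by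
    have h1 : Filter.Tendsto (fun n => Y (t (j n))) Filter.atTop (nhds (Y τ)) :=
      (hY.continuous.tendsto τ).comp htlim
    refine tendsto_iff_dist_tendsto_zero.2 (squeeze_zero (fun _ => dist_nonneg)
      (fun n => dist_triangle _ (Y (t (j n))) _) ?_)
    have h2 := squeeze_zero (fun _ => dist_nonneg)
      (fun n => hest n (t (j n)) (ht _)) hEps
    simpa using h2.add (tendsto_iff_dist_tendsto_zero.1 h1)
  obtain ⟨n, hn⟩ := (hlimτ.eventually (hΩ.mem_nhds hYΩ)).exists
  exact htΩ _ hn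

end ODE

section Planar

/-- The projection of the real line onto `[a, b]`. -/
noncomputable def clamp (a b x : ℝ) : ℝ := max a (min b x)

lemma lipschitzWith_clamp (a b : ℝ) : LipschitzWith 1 (clamp a b) :=
  (LipschitzWith.id.const_min b).const_max a

lemma clamp_mem_Icc {a b : ℝ} (hab : a ≤ b) (x : ℝ) : clamp a b x ∈ Set.Icc a b := by
  simp [clamp, hab]

lemma clamp_of_mem {a b x : ℝ} (hx : x ∈ Set.Icc a b) : clamp a b x = x := by
  simp [clamp, hx.1, hx.2]

lemma clamp_of_le_left {a b x : ℝ} (hab : a ≤ b) (hx : x ≤ a) : clamp a b x = a := by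
  simp [clamp, hx, hx.trans hab]

lemma clamp_of_right_le {a b x : ℝ} (hab : a ≤ b) (hx : b ≤ x) : clamp a b x = b := by
  simp [clamp, hx, hab]

lemma abs_clamp_le {S : ℝ} (hS : 0 ≤ S) (x : ℝ) : |clamp (-S) S x| ≤ S :=
  abs_le.2 (clamp_mem_Icc (by linarith) x)

lemma clamp_neg_neg {S : ℝ} (hS : 0 ≤ S) (x : ℝ) : clamp (-S) S (-x) = -clamp (-S) S x := by
  unfold clamp
  grind

lemma clamp_eq_zero {S : ℝ} (hS : 0 < S) {x : ℝ} (hx : clamp (-S) S x = 0) : x = 0 := by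
  unfold clamp at hx
  grind

lemma clamp_pos {S : ℝ} (hS : 0 < S) {x : ℝ} (hx : 0 < x) : 0 < clamp (-S) S x := by
  unfold clamp
  grind

lemma abs_sub_le_of_hasDerivAt {f f' : ℝ → ℝ} {L : ℝ} (hf : ∀ t, HasDerivAt f (f' t) t)
    (hL : ∀ t, |f' t| ≤ L) (s t : ℝ) : |f t - f s| ≤ L * |t - s| :=
  convex_univ.norm_image_sub_le_of_norm_hasDerivWithin_le
    (fun x _ => (hf x).hasDerivWithinAt) (fun x _ => hL x) (Set.mem_univ s) (Set.mem_univ t)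

lemma lt_of_hasDerivAt_pos {f f' : ℝ → ℝ} {a b : ℝ} (hab : a < b)
    (hf : ∀ t, HasDerivAt f (f' t) t) (hpos : ∀ t ∈ Set.Ioo a b, 0 < f' t) : f a < f b := by
  refine strictMonoOn_of_deriv_pos (convex_Icc a b)
    (fun t _ => (hf t).continuousAt.continuousWithinAt) (fun t ht => ?_)
    (Set.left_mem_Icc.2 hab.le) (Set.right_mem_Icc.2 hab.le) hab
  rw [interior_Icc] at ht
  rw [(hf t).deriv]
  exact hpos t ht

lemma lt_of_hasDerivAt_neg {f f' : ℝ → ℝ} {a b : ℝ} (hab : a < b)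
    (hf : ∀ t, HasDerivAt f (f' t) t) (hneg : ∀ t ∈ Set.Ioo a b, f' t < 0) : f b < f a :=
  neg_lt_neg_iff.1 (lt_of_hasDerivAt_pos (f := fun t => -f t) hab (fun t => (hf t).fun_neg)
    fun t ht => neg_pos.2 (hneg t ht))

lemma IsIntegralCurve.fst {w : ℝ → ℝ × ℝ → ℝ × ℝ} {X : ℝ → ℝ × ℝ} (hX : IsIntegralCurve X w)
    (t : ℝ) : HasDerivAt (fun t => (X t).1) (w t (X t)).1 t :=
  (ContinuousLinearMap.fst ℝ ℝ ℝ).hasFDerivAt.comp_hasDerivAt t (hX t)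

lemma IsIntegralCurve.snd {w : ℝ → ℝ × ℝ → ℝ × ℝ} {X : ℝ → ℝ × ℝ} (hX : IsIntegralCurve X w)
    (t : ℝ) : HasDerivAt (fun t => (X t).2) (w t (X t)).2 t :=
  (ContinuousLinearMap.snd ℝ ℝ ℝ).hasFDerivAt.comp_hasDerivAt t (hX t)

/-- A fixed point of the period map, obtained from the behaviour of solutions starting on the
boundary of a rectangle. -/
theorem exists_periodic_isIntegralCurve {w : ℝ → ℝ × ℝ → ℝ × ℝ} {K : NNReal}
    (hlip : ∀ t, LipschitzWith K (w t)) (hcont : ∀ x, Continuous fun t => w t x)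
    {N : ℝ} (hbdd : ∀ t x, ‖w t x‖ ≤ N) {T : ℝ} (hT : 0 < T)
    (hper : ∀ t x, w (t + T) x = w t x) {a₁ b₁ a₂ b₂ : ℝ} (h₁ : a₁ ≤ b₁) (h₂ : a₂ ≤ b₂)
    (hleft : ∀ X, IsIntegralCurve X w → (X 0).1 = a₁ → (X T).2 < (X 0).2)
    (hright : ∀ X, IsIntegralCurve X w → (X 0).1 = b₁ → (X 0).2 < (X T).2)
    (hbot : ∀ X, IsIntegralCurve X w → (X 0).2 = a₂ → (X T).1 < (X 0).1)
    (htop : ∀ X, IsIntegralCurve X w → (X 0).2 = b₂ → (X 0).1 < (X T).1) :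
    ∃ X, IsIntegralCurve X w ∧ Function.Periodic X T ∧
      X 0 ∈ Set.Icc a₁ b₁ ×ˢ Set.Icc a₂ b₂ := by
  choose X hX0 hX using exists_isIntegralCurve_of_lipschitzWith hlip hcont hbdd
  have hflow : Continuous fun x => X x T := by
    have : LipschitzWith (Real.toNNReal (rexp (K * T))) fun x => X x T := by
      refine LipschitzWith.of_dist_le_mul fun x y => ?_
      have h := dist_le_of_trajectories_ODE (f := X x) (g := X y) (a := 0) (b := T) hlip
        (hX x).continuous.continuousOn (fun t _ => (hX x t).hasDerivWithinAt)
        (hX y).continuous.continuousOn (fun t _ => (hX y t).hasDerivWithinAt) le_rfl T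
        ⟨hT.le, le_rfl⟩
      rw [hX0, hX0, sub_zero] at h
      rw [Real.coe_toNNReal _ (exp_pos _).le, mul_comm]
      exact h
    exact this.continuous
  obtain ⟨z, hz, hz0⟩ := poincare_miranda h₁ h₂ (F := fun x => X x T - x) (by fun_prop)
    (fun y _ => by simpa [hX0] using hleft _ (hX (a₁, y)) (by rw [hX0]))
    (fun y _ => by simpa [hX0] using hright _ (hX (b₁, y)) (by rw [hX0]))
    (fun x _ => by simpa [hX0] using hbot _ (hX (x, a₂)) (by rw [hX0]))
    (fun x _ => by simpa [hX0] using htop _ (hX (x, b₂)) (by rw [hX0]))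
  refine ⟨X z, hX z, (hX z).periodic hlip hper ?_, by rwa [hX0]⟩
  rw [hX0]
  exact sub_eq_zero.1 hz0

/-- A planar field that is a small perturbation of a saturated drift `q' = p` and a saturated
expelling force outside `[α, β]` has a periodic solution, starting in an explicit rectangle. -/
theorem exists_periodic_of_saturated {w : ℝ → ℝ × ℝ → ℝ × ℝ} {K : NNReal}
    (hlip : ∀ t, LipschitzWith K (w t)) (hcont : ∀ x, Continuous fun t => w t x)
    {T : ℝ} (hT : 0 < T) (hper : ∀ t x, w (t + T) x = w t x) {α β S E B N : ℝ} (hαβ : α ≤ β)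
    (hB : 0 ≤ B) (hBS : B < S) (hN : 0 ≤ N) (hNE : N < E)
    (hw₁ : ∀ t x, |(w t x).1 - clamp (-S) S x.2| ≤ B)
    (hw₂ : ∀ t x, |(w t x).2 - clamp (-E) E (x.1 - clamp α β x.1)| ≤ N) :
    ∃ X, IsIntegralCurve X w ∧ Function.Periodic X T ∧
      X 0 ∈ Set.Icc (α - E - (S + B) * T) (β + E + (S + B) * T) ×ˢ
        Set.Icc (-(S + (E + N) * T)) (S + (E + N) * T) := by
  have hS : 0 ≤ S := hB.trans hBS.le
  have hE : 0 ≤ E := hN.trans hNE.le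
  have hb₁ : ∀ t x, |(w t x).1| ≤ S + B := fun t x => by
    have h1 := abs_clamp_le hS x.2
    have h2 := hw₁ t x
    rw [abs_le] at *
    constructor <;> linarith
  have hb₂ : ∀ t x, |(w t x).2| ≤ E + N := fun t x => by
    have h1 := abs_clamp_le hE (x.1 - clamp α β x.1)
    have h2 := hw₂ t x
    rw [abs_le] at *
    constructor <;> linarith
  have hd₁ : ∀ X, IsIntegralCurve X w → ∀ t ∈ Set.Ioo 0 T,
      |(X t).1 - (X 0).1| ≤ (S + B) * T := fun X hX t ht =>
    (abs_sub_le_of_hasDerivAt hX.fst (fun t => hb₁ t _) 0 t).trans <| by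
      rw [sub_zero, abs_of_pos ht.1]
      gcongr
      exact ht.2.le
  have hd₂ : ∀ X, IsIntegralCurve X w → ∀ t ∈ Set.Ioo 0 T,
      |(X t).2 - (X 0).2| ≤ (E + N) * T := fun X hX t ht =>
    (abs_sub_le_of_hasDerivAt hX.snd (fun t => hb₂ t _) 0 t).trans <| by
      rw [sub_zero, abs_of_pos ht.1]
      gcongr
      exact ht.2.le
  have hST : 0 ≤ (S + B) * T := by positivity
  have hET : 0 ≤ (E + N) * T := by positivity
  refine exists_periodic_isIntegralCurve hlip hcont (N := S + B + (E + N)) (fun t x => ?_) hT hper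
    (by linarith) (by linarith) (fun X hX h0 => ?_) (fun X hX h0 => ?_) (fun X hX h0 => ?_)
    (fun X hX h0 => ?_)
  · have h1 := hb₁ t x
    have h2 := hb₂ t x
    rw [norm_prod_le_iff]
    constructor <;> rw [Real.norm_eq_abs] <;> linarith
  · refine lt_of_hasDerivAt_neg hT hX.snd fun t ht => ?_
    have h1 := (abs_le.1 (hd₁ X hX t ht)).2
    have h2 := (abs_le.1 (hw₂ t (X t))).2
    rw [clamp_of_le_left hαβ (by linarith : (X t).1 ≤ α),
      clamp_of_le_left (by linarith) (by linarith)] at h2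
    linarith
  · refine lt_of_hasDerivAt_pos hT hX.snd fun t ht => ?_
    have h1 := (abs_le.1 (hd₁ X hX t ht)).1
    have h2 := (abs_le.1 (hw₂ t (X t))).1
    rw [clamp_of_right_le hαβ (by linarith : β ≤ (X t).1),
      clamp_of_right_le (by linarith) (by linarith)] at h2
    linarith
  · refine lt_of_hasDerivAt_neg hT hX.fst fun t ht => ?_
    have h1 := (abs_le.1 (hd₂ X hX t ht)).2
    have h2 := (abs_le.1 (hw₁ t (X t))).2
    rw [clamp_of_le_left (by linarith) (by linarith)] at h2
    linarith
  · refine lt_of_hasDerivAt_pos hT hX.fst fun t ht => ?_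
    have h1 := (abs_le.1 (hd₂ X hX t ht)).1
    have h2 := (abs_le.1 (hw₁ t (X t))).1
    rw [clamp_of_right_le (by linarith) (by linarith)] at h2
    linarith

/-- At a maximum of `q`, where `q' = clamp (-S) S p`, the derivative of `p` is nonpositive. -/
lemma deriv_nonpos_of_isMax {q p : ℝ → ℝ} {S d t₀ : ℝ} (hS : 0 < S)
    (hq : ∀ t, HasDerivAt q (clamp (-S) S (p t)) t) (hp : HasDerivAt p d t₀)
    (hmax : ∀ t, q t ≤ q t₀) : d ≤ 0 := by
  by_contra! hd
  have hp0 : p t₀ = 0 := clamp_eq_zero hS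
    ((show IsLocalMax q t₀ from Filter.Eventually.of_forall hmax).hasDerivAt_eq_zero (hq t₀))
  have hev : ∀ᶠ t in nhds t₀, t₀ < t → 0 < p t := by
    filter_upwards [eventually_nhdsWithin_sign_eq_of_deriv_pos (hp.deriv.symm ▸ hd) hp0]
      with t ht hlt
    rw [sign_pos (sub_pos.2 hlt)] at ht
    exact sign_eq_one_iff.1 ht
  obtain ⟨ε, hε, hball⟩ := Metric.eventually_nhds_iff.1 hev
  have : q t₀ < q (t₀ + ε / 2) := by
    refine lt_of_hasDerivAt_pos (by linarith) hq fun t ht => clamp_pos hS (hball ?_ ht.1)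
    rw [Real.dist_eq, abs_lt]
    constructor <;> linarith [ht.1, ht.2]
  exact absurd (hmax _) (not_le.2 this)

lemma deriv_nonneg_of_isMin {q p : ℝ → ℝ} {S d t₀ : ℝ} (hS : 0 < S)
    (hq : ∀ t, HasDerivAt q (clamp (-S) S (p t)) t) (hp : HasDerivAt p d t₀)
    (hmin : ∀ t, q t₀ ≤ q t) : 0 ≤ d := by
  have := deriv_nonpos_of_isMax (q := fun t => -q t) (p := fun t => -p t) hS
    (fun t => by rw [clamp_neg_neg hS.le]; exact (hq t).fun_neg) hp.fun_neg
    (fun t => neg_le_neg (hmin t))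
  linarith

lemma Function.Periodic.exists_isMax {q : ℝ → ℝ} {T : ℝ} (hper : Function.Periodic q T)
    (hT : 0 < T) (hq : Continuous q) : ∃ t₀, ∀ t, q t ≤ q t₀ := by
  obtain ⟨t₀, -, h⟩ := isCompact_Icc.exists_isMaxOn (Set.nonempty_Icc.2 hT.le) hq.continuousOn
  refine ⟨t₀, fun t => ?_⟩
  obtain ⟨s, hs, hst⟩ := hper.exists_mem_Ico₀ hT t
  rw [hst]
  exact h ⟨hs.1, hs.2.le⟩

lemma Function.Periodic.exists_abs_le {q : ℝ → ℝ} {T : ℝ} (hper : Function.Periodic q T)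
    (hT : 0 < T) (hq : Continuous q) : ∃ B, ∀ t, |q t| ≤ B := by
  obtain ⟨t₀, h⟩ := Function.Periodic.exists_isMax (q := fun t => |q t|)
    (fun t => by simp only [hper t]) hT hq.abs
  exact ⟨_, h⟩

/-- The field `q' = p`, `p' = -μ p + H`, saturated in `p` and frozen outside `α ≤ q ≤ β`, with an
additional force pushing away from `[α, β]`. -/
noncomputable def saturatedField (μ α β S E : ℝ) (H : ℝ → ℝ → ℝ → ℝ) (t : ℝ) (x : ℝ × ℝ) : ℝ × ℝ :=
  (clamp (-S) S x.2, -μ * clamp (-S) S x.2 + H (clamp α β x.1) (clamp (-S) S x.2) t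
    + clamp (-E) E (x.1 - clamp α β x.1))

variable {μ α β S E T : ℝ} {H : ℝ → ℝ → ℝ → ℝ}

lemma saturatedField_add_period (hper : ∀ q p, Function.Periodic (H q p) T) (t : ℝ) (x : ℝ × ℝ) :
    saturatedField μ α β S E H (t + T) x = saturatedField μ α β S E H t x := by
  simp only [saturatedField, hper _ _ t]

lemma continuous_saturatedField (hH : Continuous fun z : ℝ × ℝ × ℝ => H z.1 z.2.1 z.2.2)
    (x : ℝ × ℝ) : Continuous fun t => saturatedField μ α β S E H t x := by
  have : Continuous fun t => H (clamp α β x.1) (clamp (-S) S x.2) t :=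
    hH.comp (by fun_prop : Continuous fun t : ℝ => (clamp α β x.1, clamp (-S) S x.2, t))
  unfold saturatedField
  fun_prop

lemma exists_lipschitzWith_saturatedField (hT : 0 < T) (hαβ : α ≤ β) (hS : 0 ≤ S)
    (hH : ContDiff ℝ 1 fun z : ℝ × ℝ × ℝ => H z.1 z.2.1 z.2.2)
    (hper : ∀ q p, Function.Periodic (H q p) T) :
    ∃ K, ∀ t, LipschitzWith K (saturatedField μ α β S E H t) := by
  obtain ⟨L, hL⟩ := hH.locallyLipschitz.locallyLipschitzOn.exists_lipschitzOnWith_of_compact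
    ((isCompact_Icc (a := α) (b := β)).prod
      ((isCompact_Icc (a := -S) (b := S)).prod (isCompact_Icc (a := 0) (b := T))))
  have hc₁ : LipschitzWith 1 fun x : ℝ × ℝ => clamp α β x.1 := by
    simpa [Function.comp_def] using (lipschitzWith_clamp α β).comp LipschitzWith.prod_fst
  have hc₂ : LipschitzWith 1 fun x : ℝ × ℝ => clamp (-S) S x.2 := by
    simpa [Function.comp_def] using (lipschitzWith_clamp (-S) S).comp LipschitzWith.prod_snd
  have hμ : LipschitzWith (‖-μ‖₊ * 1) fun x : ℝ × ℝ => -μ * clamp (-S) S x.2 :=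
    (lipschitzWith_smul (-μ)).comp hc₂
  have hE : LipschitzWith (1 * (1 + 1)) fun x : ℝ × ℝ => clamp (-E) E (x.1 - clamp α β x.1) :=
    (lipschitzWith_clamp (-E) E).comp (LipschitzWith.prod_fst.sub hc₁)
  refine ⟨_, fun t => hc₂.prodMk ((hμ.add (?_ : LipschitzWith L _)).add hE)⟩
  refine LipschitzWith.of_dist_le_mul fun x y => ?_
  have hs' : ∀ q p, H q p t = H q p (toIcoMod hT 0 t) := fun q p =>
    (((hper q p).sub_zsmul_eq (toIcoDiv hT 0 t)).symm)
  have hmem := toIcoMod_mem_Ico hT 0 t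
  rw [zero_add] at hmem
  rw [hs', hs']
  refine (hL.dist_le_mul (clamp α β x.1, clamp (-S) S x.2, toIcoMod hT 0 t)
    ⟨clamp_mem_Icc hαβ _, clamp_mem_Icc (by linarith) _, hmem.1, hmem.2.le⟩
    (clamp α β y.1, clamp (-S) S y.2, toIcoMod hT 0 t)
    ⟨clamp_mem_Icc hαβ _, clamp_mem_Icc (by linarith) _, hmem.1, hmem.2.le⟩).trans ?_
  gcongr
  simp only [Prod.dist_eq, dist_self]
  have e1 := hc₁.dist_le_mul x y
  have e2 := hc₂.dist_le_mul x y
  simp only [NNReal.coe_one, one_mul] at e1 e2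
  rw [Prod.dist_eq] at e1 e2
  exact max_le e1 (max_le e2 (le_max_of_le_left dist_nonneg))

/-- Periodic solutions of the saturated field do not meet the region where it was modified. -/
theorem mem_of_periodic_saturatedField {C M : ℝ} (hT : 0 < T) (hS : 0 < S) (hE : 0 ≤ E)
    (hαβ : α ≤ β) (hC : ∀ q p t, |H q p t| ≤ C) (hM : |μ| * (β - α) + C * T < M)
    (hα : ∀ t, H α 0 t < 0) (hβ : ∀ t, 0 < H β 0 t) {Y : ℝ → ℝ × ℝ}
    (hY : IsIntegralCurve Y (saturatedField μ α β S E H)) (hper : Function.Periodic Y T) (t : ℝ) :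
    Y t ∈ Set.Ioo α β ×ˢ Set.Ioo (-M) M := by
  have hq : ∀ t, HasDerivAt (fun t => (Y t).1) (clamp (-S) S (Y t).2) t := hY.fst
  have hqc : Continuous fun t => (Y t).1 := continuous_fst.comp hY.continuous
  have hqper : Function.Periodic (fun t => (Y t).1) T := fun t => by simp only [hper t]
  have hpzero : ∀ t, clamp (-S) S (Y t).2 = 0 → (saturatedField μ α β S E H t (Y t)).2 =
      H (clamp α β (Y t).1) 0 t + clamp (-E) E ((Y t).1 - clamp α β (Y t).1) := fun t ht => by
    simp [saturatedField, ht]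
  have hlt : ∀ t, (Y t).1 < β := by
    obtain ⟨t₀, hmax⟩ := hqper.exists_isMax hT hqc
    refine fun t => (hmax t).trans_lt ?_
    by_contra! hge
    have h1 := deriv_nonpos_of_isMax hS hq (hY.snd t₀) hmax
    rw [hpzero t₀ ((show IsLocalMax (fun t => (Y t).1) t₀ from
      Filter.Eventually.of_forall hmax).hasDerivAt_eq_zero (hq t₀)),
      clamp_of_right_le hαβ hge] at h1
    have h2 : 0 ≤ clamp (-E) E ((Y t₀).1 - β) := by
      unfold clamp
      exact le_max_of_le_right (le_min hE (sub_nonneg.2 hge))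
    linarith [hβ t₀]
  have hgt : ∀ t, α < (Y t).1 := by
    obtain ⟨t₀, hmin⟩ := Function.Periodic.exists_isMax (q := fun t => -(Y t).1)
      (fun t => by simp only [hper t]) hT hqc.neg
    have hmin : ∀ t, (Y t₀).1 ≤ (Y t).1 := fun t => neg_le_neg_iff.1 (hmin t)
    refine fun t => (hmin t).trans_lt' ?_
    by_contra! hge
    have h1 := deriv_nonneg_of_isMin hS hq (hY.snd t₀) hmin
    rw [hpzero t₀ ((show IsLocalMin (fun t => (Y t).1) t₀ from
      Filter.Eventually.of_forall hmin).hasDerivAt_eq_zero (hq t₀)),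
      clamp_of_le_left hαβ hge] at h1
    have h2 : clamp (-E) E ((Y t₀).1 - α) ≤ 0 := by
      unfold clamp
      exact max_le (neg_nonpos.2 hE) (min_le_of_right_le (sub_nonpos.2 hge))
    linarith [hα t₀]
  obtain ⟨c, -, hc⟩ := exists_hasDerivAt_eq_zero hT hqc.continuousOn
    (by simpa using (hqper 0).symm) (fun t _ => hq t)
  have hpc : (Y c).2 = 0 := clamp_eq_zero hS hc
  have hE0 : clamp (-E) E 0 = 0 := clamp_of_mem ⟨neg_nonpos.2 hE, hE⟩
  have hu : ∀ t, HasDerivAt (fun t => (Y t).2 + μ * (Y t).1)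
      (H (Y t).1 (clamp (-S) S (Y t).2) t) t := fun t => by
    refine ((hY.snd t).fun_add ((hq t).const_mul μ)).congr_deriv ?_
    simp only [saturatedField, clamp_of_mem (⟨(hgt t).le, (hlt t).le⟩ : (Y t).1 ∈ Set.Icc α β),
      sub_self, hE0]
    ring
  refine ⟨⟨hgt t, hlt t⟩, ?_⟩
  obtain ⟨s, hs, hst⟩ := hper.exists_mem_Ico hT t c
  rw [hst]
  have h1 := abs_sub_le_of_hasDerivAt hu (fun t => hC _ _ _) c s
  have hC0 : 0 ≤ C := (abs_nonneg _).trans (hC 0 0 0)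
  have h2 : C * |s - c| ≤ C * T := by
    gcongr
    rw [abs_of_nonneg (by linarith [hs.1])]
    linarith [hs.2]
  have h3 : |μ * ((Y s).1 - (Y c).1)| ≤ |μ| * (β - α) := by
    rw [abs_mul]
    gcongr
    rw [abs_le]
    constructor <;> linarith [hgt s, hlt s, hgt c, hlt c]
  have h4 : |(Y s).2| < M := by
    calc |(Y s).2| = |((Y s).2 + μ * (Y s).1 - ((Y c).2 + μ * (Y c).1))
          - μ * ((Y s).1 - (Y c).1)| := by rw [hpc]; congr 1; ring
      _ ≤ C * T + |μ| * (β - α) :=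
          (abs_sub _ _).trans (add_le_add (h1.trans h2) h3)
      _ < M := by linarith
  exact abs_lt.1 h4

end Planar

section Kapitza

lemma Function.Periodic.exists_bounded_primitive {a : ℝ → ℝ} {T : ℝ}
    (hper : Function.Periodic a T) (hT : 0 < T) (ha : Continuous a)
    (hmean : ∫ t in (0 : ℝ)..T, a t = 0) :
    ∃ A : ℝ → ℝ, (∀ t, HasDerivAt A (a t) t) ∧ ∃ N, ∀ t, |A t| ≤ N := by
  have hA : ∀ t, HasDerivAt (fun t => ∫ s in (0 : ℝ)..t, a s) (a t) t := fun t =>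
    intervalIntegral.integral_hasDerivAt_right (ha.intervalIntegrable _ _)
      ha.stronglyMeasurable.stronglyMeasurableAtFilter ha.continuousAt
  refine ⟨_, hA, Function.Periodic.exists_abs_le (T := T) (fun t => ?_) hT
    (continuous_iff_continuousAt.2 fun t => (hA t).continuousAt)⟩
  have h := hper.intervalIntegral_add_eq t 0
  rw [zero_add, hmean] at h
  rw [← intervalIntegral.integral_add_adjacent_intervals (ha.intervalIntegrable 0 t)
    (ha.intervalIntegrable t (t + T)), h, add_zero]

lemma exists_smooth_truncation (M : ℝ) :
    ∃ ρ : ℝ → ℝ, ContDiff ℝ 1 ρ ∧ (∃ L, LipschitzWith L ρ) ∧ (∃ B, ∀ p, |ρ p| ≤ B) ∧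
      ∀ p, |p| ≤ M → ρ p = p := by
  let f : ContDiffBump (0 : ℝ) := ⟨max M 1, max M 1 + 1, by positivity, by linarith⟩
  have hcd : ContDiff ℝ 1 fun p => p * f p := contDiff_id.mul f.contDiff
  have hsupp : HasCompactSupport fun p => p * f p := f.hasCompactSupport.mul_left
  refine ⟨fun p => p * f p, hcd, hcd.lipschitzWith_of_hasCompactSupport hsupp one_ne_zero,
    hcd.continuous.bounded_above_of_compact_support hsupp, fun p hp => ?_⟩
  have : f p = 1 := f.one_of_mem_closedBall (by simpa [f] using Or.inl hp)
  simp [this]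

lemma LipschitzWith.mul_of_abs_le {E : Type*} [PseudoMetricSpace E] {f g : E → ℝ} {K L : NNReal}
    {B C : ℝ} (hf : LipschitzWith K f) (hg : LipschitzWith L g) (hfB : ∀ x, |f x| ≤ B)
    (hgC : ∀ x, |g x| ≤ C) : ∃ M, LipschitzWith M fun x => f x * g x := by
  refine ⟨Real.toNNReal (B * L + C * K), LipschitzWith.of_dist_le' fun x y => ?_⟩
  have h₁ := hf.dist_le_mul x y
  have h₂ := hg.dist_le_mul x y
  rw [Real.dist_eq] at *
  calc |f x * g x - f y * g y| = |f x * (g x - g y) + g y * (f x - f y)| := by ring_nf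
    _ ≤ |f x| * |g x - g y| + |g y| * |f x - f y| := by
      rw [← abs_mul, ← abs_mul]; exact abs_add_le _ _
    _ ≤ B * (L * dist x y) + C * (K * dist x y) := by
      have := (abs_nonneg _).trans (hfB x)
      have := (abs_nonneg _).trans (hgC x)
      gcongr
      exacts [hfB x, hgC y]
    _ = _ := by ring

lemma exists_lipschitzWith_add_sum_smul {ι E : Type*} [Fintype ι] [NormedAddCommGroup E]
    [NormedSpace ℝ E] {v : ℝ → E → E} {K : NNReal} (hv : ∀ t, LipschitzWith K (v t))
    {a : ι → ℝ → ℝ} {g : ι → E → E} {N : ℝ} {L : NNReal} (ha : ∀ i t, |a i t| ≤ N)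
    (hg : ∀ i, LipschitzWith L (g i)) :
    ∃ K', ∀ (k : ℕ) t, LipschitzWith K' fun x => v t x + ∑ i, a i (k * t) • g i x := by
  refine ⟨Real.toNNReal (K + ∑ _i : ι, N * L), fun k t => LipschitzWith.of_dist_le' fun x y => ?_⟩
  refine (dist_add_add_le _ _ _ _).trans ?_
  rw [add_mul, Finset.sum_mul]
  refine add_le_add ((hv t).dist_le_mul x y) ((dist_sum_sum_le _ _ _).trans
    (Finset.sum_le_sum fun i _ => ?_))
  rw [dist_eq_norm, ← smul_sub, norm_smul, Real.norm_eq_abs, ← dist_eq_norm, mul_assoc]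
  have := (abs_nonneg _).trans (ha i 0)
  gcongr
  exacts [ha i _, (hg i).dist_le_mul x y]

/-- The two components of the rapidly oscillating part of the system, with the momentum truncated
by `ρ`. They are multiplied by `φ` and by the oscillation of `φ ^ 2`, respectively. -/
noncomputable def oscillatingField (μ : ℝ) (ρ : ℝ → ℝ) : Fin 2 → ℝ × ℝ → ℝ × ℝ :=
  ![fun x => (-sin x.1, μ * sin x.1 + ρ x.2 * cos x.1), fun x => (0, -(sin (2 * x.1) / 2))]

lemma contDiff_oscillatingField (μ : ℝ) {ρ : ℝ → ℝ} (hρ : ContDiff ℝ 1 ρ) (i : Fin 2) :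
    ContDiff ℝ 1 (oscillatingField μ ρ i) := by
  fin_cases i <;> simp only [oscillatingField] <;> simp <;> fun_prop

lemma exists_lipschitzWith_oscillatingField (μ : ℝ) {ρ : ℝ → ℝ} {L : NNReal} {B : ℝ}
    (hρ : LipschitzWith L ρ) (hB : ∀ p, |ρ p| ≤ B) :
    ∃ K, ∀ i, LipschitzWith K (oscillatingField μ ρ i) := by
  have hs : LipschitzWith 1 fun x : ℝ × ℝ => sin x.1 := by
    simpa [Function.comp_def] using
      Real.lipschitzWith_sin.comp (LipschitzWith.prod_fst (α := ℝ) (β := ℝ))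
  have hc : LipschitzWith 1 fun x : ℝ × ℝ => cos x.1 := by
    simpa [Function.comp_def] using
      Real.lipschitzWith_cos.comp (LipschitzWith.prod_fst (α := ℝ) (β := ℝ))
  have hρ' := hρ.comp (LipschitzWith.prod_snd (α := ℝ) (β := ℝ))
  obtain ⟨M₁, h₁⟩ := hρ'.mul_of_abs_le hc (fun x => hB x.2) fun x => abs_cos_le_one x.1
  obtain ⟨M₂, h₂⟩ := hs.mul_of_abs_le hc (fun x => abs_sin_le_one x.1) fun x => abs_cos_le_one x.1
  obtain ⟨M₃, h₃⟩ := (LipschitzWith.const μ).mul_of_abs_le hs (fun _ => le_rfl)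
    fun x => abs_sin_le_one x.1
  have h₄ : LipschitzWith M₂ fun x : ℝ × ℝ => sin (2 * x.1) / 2 := by
    have : (fun x : ℝ × ℝ => sin (2 * x.1) / 2) = fun x => sin x.1 * cos x.1 := by
      ext x
      rw [sin_two_mul]
      ring
    rwa [this]
  refine ⟨max (max 1 (M₃ + M₁)) M₂, Fin.forall_fin_two.2 ⟨?_, ?_⟩⟩
  · exact (hs.neg.prodMk (h₃.add h₁)).weaken (le_max_left _ _)
  · exact ((LipschitzWith.const 0).prodMk h₄.neg).weaken (by simp)

lemma oscillatingField_smul (μ : ℝ) (ρ : ℝ → ℝ) (φ : ℝ → ℝ) (Φ t : ℝ) (x : ℝ × ℝ) :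
    ∑ i, (![φ, fun s => φ s ^ 2 - Φ] : Fin 2 → ℝ → ℝ) i t • oscillatingField μ ρ i x =
      (-(φ t * sin x.1), φ t * (μ * sin x.1 + ρ x.2 * cos x.1) -
        (φ t ^ 2 - Φ) / 2 * sin (2 * x.1)) := by
  simp only [Fin.sum_univ_two, oscillatingField]
  ext <;> simp
  ring

/-- If the averaged system `q' = p`, `p' = -μ p + H q p t` is repelled from the boundary of the
strip `α < q < β` at zero momentum, the oscillating system has a periodic solution in that strip
for all sufficiently large frequencies. -/
theorem exists_periodic_mem_Ioo {T μ Φ α β C : ℝ} (hT : 0 < T) (hαβ : α ≤ β) {φ : ℝ → ℝ}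
    (hφ : Continuous φ) (hφper : Function.Periodic φ T) (hφavg : ∫ t in (0 : ℝ)..T, φ t = 0)
    (hΦ : Φ = (1 / T) * ∫ t in (0 : ℝ)..T, φ t ^ 2) {H : ℝ → ℝ → ℝ → ℝ}
    (hH : ContDiff ℝ 1 fun z : ℝ × ℝ × ℝ => H z.1 z.2.1 z.2.2)
    (hper : ∀ q p, Function.Periodic (H q p) T) (hC : ∀ q p t, |H q p t| ≤ C)
    (hα : ∀ t, H α 0 t < 0) (hβ : ∀ t, 0 < H β 0 t) :
    ∃ k₀ : ℕ, ∀ k : ℕ, k₀ < k → ∃ q p : ℝ → ℝ, Function.Periodic q T ∧ Function.Periodic p T ∧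
      (∀ t, q t ∈ Set.Ioo α β) ∧
      (∀ t, HasDerivAt q (p t - φ (k * t) * sin (q t)) t) ∧
      ∀ t, HasDerivAt p (-μ * p t + H (q t) (p t) t +
        (φ (k * t) * (μ * sin (q t) + p t * cos (q t)) -
          (φ (k * t) ^ 2 - Φ) / 2 * sin (2 * q t))) t := by
  have hφ₂per : Function.Periodic (fun t => φ t ^ 2 - Φ) T := fun t => by simp [hφper t]
  have hφ₂ : Continuous fun t => φ t ^ 2 - Φ := by fun_prop
  have hφ₂avg : ∫ t in (0 : ℝ)..T, (φ t ^ 2 - Φ) = 0 := by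
    rw [intervalIntegral.integral_sub ((by fun_prop : Continuous fun t => φ t ^ 2).intervalIntegrable
      _ _) intervalIntegrable_const, intervalIntegral.integral_const, hΦ, smul_eq_mul]
    field_simp
    ring
  obtain ⟨A₁, hA₁, N₁, hN₁⟩ := hφper.exists_bounded_primitive hT hφ hφavg
  obtain ⟨A₂, hA₂, N₂, hN₂⟩ := hφ₂per.exists_bounded_primitive hT hφ₂ hφ₂avg
  obtain ⟨B₁, hB₁⟩ := hφper.exists_abs_le hT hφ
  obtain ⟨B₂, hB₂⟩ := hφ₂per.exists_abs_le hT hφ₂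
  have hB₁0 := (abs_nonneg _).trans (hB₁ 0)
  have hB₂0 := (abs_nonneg _).trans (hB₂ 0)
  have hC0 := (abs_nonneg _).trans (hC 0 0 0)
  set M := |μ| * (β - α) + C * T + 1 with hM
  obtain ⟨ρ, hρ, ⟨Lρ, hLρ⟩, ⟨R, hR⟩, hρid⟩ := exists_smooth_truncation M
  have hR0 := (abs_nonneg _).trans (hR 0)
  set S := max (B₁ + 1) M
  have hMS : M ≤ S := le_max_right _ _
  have hBS : B₁ < S := (lt_add_one _).trans_le (le_max_left _ _)
  have hS : 0 < S := hB₁0.trans_lt hBS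
  set N := |μ| * S + C + (B₁ * (|μ| + R) + B₂) with hN
  have hN0 : 0 ≤ N := by positivity
  set E := N + 1
  have hE : 0 ≤ E := by positivity
  set v := saturatedField μ α β S E H with hv
  obtain ⟨K, hK⟩ := exists_lipschitzWith_saturatedField (μ := μ) (E := E) hT hαβ hS.le hH hper
  obtain ⟨L, hL⟩ := exists_lipschitzWith_oscillatingField μ hLρ hR
  set a : Fin 2 → ℝ → ℝ := ![φ, fun s => φ s ^ 2 - Φ] with ha
  set g := oscillatingField μ ρ with hg
  obtain ⟨K', hK'⟩ := exists_lipschitzWith_add_sum_smul hK (a := a) (N := max B₁ B₂)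
    (Fin.forall_fin_two.2 ⟨fun t => (hB₁ t).trans (le_max_left _ _),
      fun t => (hB₂ t).trans (le_max_right _ _)⟩) hL
  have hosc₁ : ∀ t (x : ℝ × ℝ), |φ t * sin x.1| ≤ B₁ := fun t x => by
    rw [abs_mul]
    exact (mul_le_of_le_one_right (abs_nonneg _) (abs_sin_le_one _)).trans (hB₁ t)
  have hosc : ∀ x : ℝ × ℝ, |μ * sin x.1 + ρ x.2 * cos x.1| ≤ |μ| + R := fun x => by
    refine (abs_add_le _ _).trans (add_le_add ?_ ?_)
    · rw [abs_mul]
      exact mul_le_of_le_one_right (abs_nonneg _) (abs_sin_le_one _)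
    · rw [abs_mul]
      exact (mul_le_of_le_one_right (abs_nonneg _) (abs_cos_le_one _)).trans (hR _)
  have hosc₂ : ∀ t (x : ℝ × ℝ), |φ t * (μ * sin x.1 + ρ x.2 * cos x.1) -
      (φ t ^ 2 - Φ) / 2 * sin (2 * x.1)| ≤ B₁ * (|μ| + R) + B₂ := fun t x => by
    refine (abs_sub _ _).trans (add_le_add ?_ ?_)
    · rw [abs_mul]
      exact mul_le_mul (hB₁ t) (hosc x) (abs_nonneg _) hB₁0
    · rw [abs_mul, abs_div, abs_two]
      refine (mul_le_of_le_one_right (by positivity) (abs_sin_le_one _)).trans ?_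
      linarith [hB₂ t, abs_nonneg (φ t ^ 2 - Φ)]
  have hv₂ : ∀ t (x : ℝ × ℝ), |-μ * clamp (-S) S x.2 +
      H (clamp α β x.1) (clamp (-S) S x.2) t| ≤ |μ| * S + C := fun t x => by
    refine (abs_add_le _ _).trans (add_le_add ?_ (hC _ _ _))
    rw [abs_mul, abs_neg]
    exact mul_le_mul_of_nonneg_left (abs_clamp_le hS.le _) (abs_nonneg _)
  have hw₁ : ∀ (k : ℕ) t x, |(v t x + ∑ i, a i (k * t) • g i x).1 - clamp (-S) S x.2| ≤ B₁ := by
    intro k t x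
    rw [ha, hg, oscillatingField_smul]
    simpa [hv, saturatedField] using hosc₁ (k * t) x
  have hw₂ : ∀ (k : ℕ) t x, |(v t x + ∑ i, a i (k * t) • g i x).2 -
      clamp (-E) E (x.1 - clamp α β x.1)| ≤ N := by
    intro k t x
    rw [ha, hg, oscillatingField_smul]
    refine le_trans (le_of_eq ?_) ((abs_add_le _ _).trans
      (add_le_add (hv₂ t x) (hosc₂ (k * t) x)))
    simp only [hv, saturatedField, Prod.snd_add]
    ring_nf
  have hwb : ∀ (k : ℕ) t x, ‖v t x + ∑ i, a i (k * t) • g i x‖ ≤ S + B₁ + (E + N) := by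
    intro k t x
    refine (max_le_add_of_nonneg (norm_nonneg _) (norm_nonneg _)).trans (add_le_add ?_ ?_)
    · have := abs_le.1 (hw₁ k t x)
      have := abs_le.1 (abs_clamp_le hS.le x.2)
      exact abs_le.2 ⟨by linarith, by linarith⟩
    · have := abs_le.1 (hw₂ k t x)
      have := abs_le.1 (abs_clamp_le hE (x.1 - clamp α β x.1))
      exact abs_le.2 ⟨by linarith, by linarith⟩
  have hvb : ∀ t x, ‖v t x‖ ≤ S + (E + N) := by
    intro t x
    refine (max_le_add_of_nonneg (norm_nonneg _) (norm_nonneg _)).trans (add_le_add ?_ ?_)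
    · exact abs_clamp_le hS.le _
    · have := (hv₂ t x).trans (le_add_of_nonneg_right (by positivity : 0 ≤ B₁ * (|μ| + R) + B₂))
      rw [add_comm E]
      exact (abs_add_le _ _).trans (add_le_add this (abs_clamp_le hE _))
  have hgb : ∀ i x, ‖g i x‖ ≤ 1 + (|μ| + R + 1) := by
    refine Fin.forall_fin_two.2 ⟨fun x => ?_, fun x => ?_⟩ <;>
      refine (max_le_add_of_nonneg (norm_nonneg _) (norm_nonneg _)).trans (add_le_add ?_ ?_)
    · simpa [hg, oscillatingField] using abs_sin_le_one x.1
    · exact (hosc x).trans (le_add_of_nonneg_right zero_le_one)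
    · simp [hg, oscillatingField]
    · have := abs_sin_le_one (2 * x.1)
      have : |sin (2 * x.1)| / 2 ≤ |μ| + R + 1 := by linarith [abs_nonneg μ]
      simpa [hg, oscillatingField] using this
  obtain ⟨D, hD⟩ := exists_dist_le_of_oscillating (a := a) (A := ![A₁, A₂]) (g := g)
    (g' := fun i => fderiv ℝ (g i)) hK
    (N := max (max N₁ N₂) (max (max (1 + (|μ| + R + 1)) L) (S + B₁ + (E + N))))
    (Fin.forall_fin_two.2 ⟨hA₁, hA₂⟩)
    (Fin.forall_fin_two.2 ⟨fun t => (hN₁ t).trans (by simp), fun t => (hN₂ t).trans (by simp)⟩)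
    (fun i x => ((contDiff_oscillatingField μ hρ i).differentiable one_ne_zero x).hasFDerivAt)
    (fun i x => (hgb i x).trans (by simp))
    (fun i x => (norm_fderiv_le_of_lipschitz ℝ (hL i)).trans (by simp))
    (fun k t x => (hwb k t x).trans (by simp)) T
  have hvcont := continuous_saturatedField (μ := μ) (α := α) (β := β) (S := S) (E := E)
    hH.continuous
  have hvper := saturatedField_add_period (μ := μ) (α := α) (β := β) (S := S) (E := E) hper
  obtain ⟨k₀, hk₀⟩ := exists_forall_periodic_mem_of_averaged hK hvcont hvb hT hvper hD
    (isCompact_Icc.prod isCompact_Icc) (isOpen_Ioo.prod isOpen_Ioo)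
    (fun Y hY hYper t => mem_of_periodic_saturatedField hT hS hE hαβ hC (lt_add_one _) hα hβ hY
      hYper t)
  refine ⟨k₀, fun k hk => ?_⟩
  have hacont : ∀ i, Continuous (a i) := Fin.forall_fin_two.2 ⟨hφ, hφ₂⟩
  have haper : ∀ i t, a i (k * (t + T)) = a i (k * t) := by
    have : ∀ i, Function.Periodic (a i) T := Fin.forall_fin_two.2 ⟨hφper, hφ₂per⟩
    intro i t
    rw [mul_add]
    exact (this i).nat_mul k _
  obtain ⟨X, hX, hXper, hX0⟩ := exists_periodic_of_saturated (hK' k)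
    (fun x => (hvcont x).add (continuous_finsetSum _ fun i _ =>
      ((hacont i).comp (continuous_const.mul continuous_id)).smul continuous_const)) hT
    (fun t x => by simp only [haper]; rw [hvper]) hαβ hB₁0 hBS hN0 (lt_add_one N) (hw₁ k) (hw₂ k)
  have hXmem := hk₀ k hk X hX hXper hX0
  have hvX : ∀ t, saturatedField μ α β S E H t (X t) =
      ((X t).2, -μ * (X t).2 + H (X t).1 (X t).2 t) := fun t => by
    obtain ⟨h₁, h₂⟩ := hXmem t
    have h₂' : (X t).2 ∈ Set.Icc (-S) S := ⟨by linarith [h₂.1], by linarith [h₂.2]⟩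
    rw [saturatedField, clamp_of_mem (Set.Ioo_subset_Icc_self h₁), clamp_of_mem h₂', sub_self,
      clamp_of_mem (x := 0) ⟨by linarith, hE⟩, add_zero]
  have hρX : ∀ t, ρ (X t).2 = (X t).2 := fun t =>
    hρid _ (abs_le.2 (Set.Ioo_subset_Icc_self (hXmem t).2))
  refine ⟨fun t => (X t).1, fun t => (X t).2, fun t => congrArg Prod.fst (hXper t),
    fun t => congrArg Prod.snd (hXper t), fun t => (hXmem t).1, fun t => ?_, fun t => ?_⟩
  · have := hX.fst t
    simp only [ha, hg, oscillatingField_smul, hvX, Prod.fst_add, ← sub_eq_add_neg] at this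
    exact this
  · have := hX.snd t
    simp only [ha, hg, oscillatingField_smul, hvX, hρX, Prod.snd_add] at this
    exact this

lemma contDiff_of_hasDerivAt {E : Type*} [NormedAddCommGroup E] [NormedSpace ℝ E]
    {F : ℝ × E → E} (hF : ContDiff ℝ (⊤ : ℕ∞) F) {X : ℝ → E}
    (hX : ∀ t, HasDerivAt X (F (t, X t)) t) : ContDiff ℝ (⊤ : ℕ∞) X := by
  refine contDiff_infty.2 fun n => ?_
  induction n with
  | zero =>
    exact contDiff_zero.2 (continuous_iff_continuousAt.2 fun t => (hX t).continuousAt)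
  | succ n ih =>
    have hd : deriv X = fun t => F (t, X t) := funext fun t => (hX t).deriv
    push_cast
    refine contDiff_succ_iff_deriv.2 ⟨fun t => (hX t).differentiableAt, by simp, ?_⟩
    rw [hd]
    exact (contDiff_infty.1 hF n).comp (contDiff_id.prodMk ih)

/-- The version of `exists_periodic_mem_Ioo` for the Kapitza–Whitney pendulum. -/
theorem exists_smooth_periodic_mem_Ioo {T μ Φ α β : ℝ} (hT : 0 < T) (hαβ : α ≤ β) {φ : ℝ → ℝ}
    (hφ : ContDiff ℝ (⊤ : ℕ∞) φ) (hφper : Function.Periodic φ T)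
    (hφavg : ∫ t in (0 : ℝ)..T, φ t = 0)
    (hΦ : Φ = (1 / T) * ∫ t in (0 : ℝ)..T, φ t ^ 2) {h : ℝ → ℝ → ℝ → ℝ}
    (hsmooth : ContDiff ℝ (⊤ : ℕ∞) fun x : ℝ × ℝ × ℝ => h x.1 x.2.1 x.2.2)
    (hbdd : ∃ C : ℝ, ∀ a b t : ℝ, |h a b t| ≤ C)
    (hper : ∀ a b : ℝ, Function.Periodic (h a b) T)
    (hα : ∀ t, h α 0 t < sin α + Φ / 2 * sin (2 * α))
    (hβ : ∀ t, sin β + Φ / 2 * sin (2 * β) < h β 0 t) :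
    ∃ k₀ : ℕ, ∀ k : ℕ, k₀ < k → ∃ q p : ℝ → ℝ,
      ContDiff ℝ (⊤ : ℕ∞) q ∧ ContDiff ℝ (⊤ : ℕ∞) p ∧
      Function.Periodic q T ∧ Function.Periodic p T ∧
      (∀ t, deriv q t = p t - φ (k * t) * sin (q t)) ∧
      (∀ t, deriv p t = -μ * p t + (μ * sin (q t) + p t * cos (q t)) * φ (k * t)
        - sin (q t) - (φ (k * t)) ^ 2 / 2 * sin (2 * q t) + h (q t) (p t) t) ∧
      ∀ t, q t ∈ Set.Ioo α β := by
  obtain ⟨C, hC⟩ := hbdd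
  obtain ⟨k₀, hk₀⟩ := exists_periodic_mem_Ioo (μ := μ) (C := 1 + |Φ / 2| + C) hT hαβ hφ.continuous
    hφper hφavg hΦ (H := fun q p t => -sin q - Φ / 2 * sin (2 * q) + h q p t)
    (ContDiff.add (by fun_prop) (hsmooth.of_le (by simp)))
    (fun q p t => by simp [hper q p t])
    (fun q p t => by
      refine (abs_add_le _ _).trans (add_le_add ((abs_sub _ _).trans (add_le_add ?_ ?_)) (hC q p t))
      · rw [abs_neg]
        exact abs_sin_le_one q
      · rw [abs_mul]
        exact mul_le_of_le_one_right (abs_nonneg _) (abs_sin_le_one _))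
    (fun t => by linarith [hα t]) (fun t => by linarith [hβ t])
  refine ⟨k₀, fun k hk => ?_⟩
  obtain ⟨q, p, hqper, hpper, hmem, hq, hp⟩ := hk₀ k hk
  have hp' : ∀ t, HasDerivAt p (-μ * p t + (μ * sin (q t) + p t * cos (q t)) * φ (k * t)
      - sin (q t) - (φ (k * t)) ^ 2 / 2 * sin (2 * q t) + h (q t) (p t) t) t := fun t => by
    convert hp t using 1
    ring
  have hX : ContDiff ℝ (⊤ : ℕ∞) fun t => (q t, p t) := by
    refine contDiff_of_hasDerivAt (F := fun z : ℝ × ℝ × ℝ => (z.2.2 - φ (k * z.1) * sin z.2.1,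
      -μ * z.2.2 + (μ * sin z.2.1 + z.2.2 * cos z.2.1) * φ (k * z.1) - sin z.2.1
        - (φ (k * z.1)) ^ 2 / 2 * sin (2 * z.2.1) + h z.2.1 z.2.2 z.1)) ?_
      fun t => (hq t).prodMk (hp' t)
    have hh : ContDiff ℝ (⊤ : ℕ∞) fun z : ℝ × ℝ × ℝ => h z.2.1 z.2.2 z.1 :=
      hsmooth.comp (f := fun z : ℝ × ℝ × ℝ => (z.2.1, z.2.2, z.1)) (by fun_prop)
    have hφk : ContDiff ℝ (⊤ : ℕ∞) fun z : ℝ × ℝ × ℝ => φ (k * z.1) := hφ.comp (by fun_prop)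
    fun_prop
  exact ⟨q, p, hX.fst, hX.snd, hqper, hpper, fun t => (hq t).deriv, fun t => (hp' t).deriv, hmem⟩

end Kapitza


/-- **Theorem 2.2** (multiplicity of periodic solutions without falls). If the
mean value `Φ` of `φ²` exceeds `1` and the horizontal force `h` additionally
satisfies the sign conditions at the interior critical points
`q_max² = arccos λ₂`, `q_min² = 2π - arccos λ₂` of `f_Φ(q) = -sin q - (Φ/2) sin 2q`,
then for all sufficiently large `k` the system admits two distinct `T`-periodic
solutions `(q₁,p₁)`, `(q₂,p₂)` with `q₁(t) ∈ (π/2, q_max²)` and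
`q₂(t) ∈ (q_min², 3π/2)`. -/
theorem kapitza_whitney_two_periodic_solutions_without_falls
    (T μ Φ : ℝ) (hT : 0 < T) (hμ : 0 ≤ μ)
    (φ : ℝ → ℝ) (hφsmooth : ContDiff ℝ (⊤ : ℕ∞) φ)
    (hφper : Function.Periodic φ T)
    (hφavg : ∫ τ in (0:ℝ)..T, φ τ = 0)
    (hΦdef : Φ = (1 / T) * ∫ τ in (0:ℝ)..T, (φ τ) ^ 2)
    (hΦ : 1 < Φ)
    (lam2 qmax qmin : ℝ)
    (hlam2 : lam2 = (-1 - Real.sqrt (1 + 8 * Φ ^ 2)) / (4 * Φ))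
    (hqmax : qmax = arccos lam2)
    (hqmin : qmin = 2 * π - arccos lam2)
    (h : ℝ → ℝ → ℝ → ℝ)
    (hsmooth : ContDiff ℝ (⊤ : ℕ∞) (fun x : ℝ × ℝ × ℝ => h x.1 x.2.1 x.2.2))
    (hbdd : ∃ C : ℝ, ∀ a b t : ℝ, |h a b t| ≤ C)
    (hper : ∀ a b : ℝ, Function.Periodic (h a b) T)
    (h1 : ∀ t : ℝ, h (π / 2) 0 t < 1)
    (h2 : ∀ t : ℝ, h (3 * π / 2) 0 t > -1)
    (h3 : ∀ t : ℝ, h qmax 0 t > -(-sin qmax - Φ / 2 * sin (2 * qmax)))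
    (h4 : ∀ t : ℝ, h qmin 0 t < -(-sin qmin - Φ / 2 * sin (2 * qmin))) :
    ∃ K : ℕ, ∀ k : ℕ, k > K →
      ∃ q₁ p₁ q₂ p₂ : ℝ → ℝ,
        ContDiff ℝ (⊤ : ℕ∞) q₁ ∧ ContDiff ℝ (⊤ : ℕ∞) p₁ ∧
        ContDiff ℝ (⊤ : ℕ∞) q₂ ∧ ContDiff ℝ (⊤ : ℕ∞) p₂ ∧
        Function.Periodic q₁ T ∧ Function.Periodic p₁ T ∧
        Function.Periodic q₂ T ∧ Function.Periodic p₂ T ∧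
        (∀ t : ℝ, deriv q₁ t = p₁ t - φ (k * t) * sin (q₁ t)) ∧
        (∀ t : ℝ, deriv p₁ t =
          -μ * p₁ t + (μ * sin (q₁ t) + p₁ t * cos (q₁ t)) * φ (k * t)
            - sin (q₁ t) - (φ (k * t)) ^ 2 / 2 * sin (2 * q₁ t)
            + h (q₁ t) (p₁ t) t) ∧
        (∀ t : ℝ, deriv q₂ t = p₂ t - φ (k * t) * sin (q₂ t)) ∧
        (∀ t : ℝ, deriv p₂ t =
          -μ * p₂ t + (μ * sin (q₂ t) + p₂ t * cos (q₂ t)) * φ (k * t)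
            - sin (q₂ t) - (φ (k * t)) ^ 2 / 2 * sin (2 * q₂ t)
            + h (q₂ t) (p₂ t) t) ∧
        (q₁, p₁) ≠ (q₂, p₂) ∧
        (∀ t : ℝ, q₁ t ∈ Set.Ioo (π / 2) qmax) ∧
        (∀ t : ℝ, q₂ t ∈ Set.Ioo qmin (3 * π / 2)) := by
  have hlam2_neg : lam2 < 0 := by
    rw [hlam2]
    exact div_neg_of_neg_of_pos (by linarith [Real.sqrt_nonneg (1 + 8 * Φ ^ 2)]) (by linarith)
  have hqmax_gt : π / 2 < qmax := by
    rw [hqmax]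
    exact lt_of_not_ge fun hle => hlam2_neg.not_ge (arccos_le_pi_div_two.1 hle)
  have hqmax_le : qmax ≤ π := hqmax ▸ arccos_le_pi lam2
  have hsum : qmin = 2 * π - qmax := by rw [hqmin, hqmax]
  have hsin₁ : sin (2 * (π / 2)) = 0 := by rw [mul_div_cancel₀ _ two_ne_zero, sin_pi]
  have hsin₂ : sin (2 * (3 * π / 2)) = 0 := by
    rw [mul_div_cancel₀ _ two_ne_zero]
    exact_mod_cast sin_nat_mul_pi 3
  have hsin₃ : sin (3 * π / 2) = -1 := by
    rw [show 3 * π / 2 = π / 2 + π by ring, sin_add_pi, sin_pi_div_two]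
  obtain ⟨k₁, hk₁⟩ := exists_smooth_periodic_mem_Ioo (μ := μ) hT hqmax_gt.le hφsmooth hφper hφavg
    hΦdef hsmooth hbdd hper (fun t => by rw [hsin₁, sin_pi_div_two]; linarith [h1 t])
    (fun t => by linarith [h3 t])
  obtain ⟨k₂, hk₂⟩ := exists_smooth_periodic_mem_Ioo (μ := μ) (α := qmin) (β := 3 * π / 2) hT
    (by linarith) hφsmooth hφper hφavg hΦdef hsmooth hbdd hper (fun t => by linarith [h4 t])
    (fun t => by rw [hsin₂, hsin₃]; linarith [h2 t])
  refine ⟨max k₁ k₂, fun k hk => ?_⟩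
  obtain ⟨q₁, p₁, hq₁, hp₁, hq₁per, hp₁per, hq₁d, hp₁d, hq₁mem⟩ :=
    hk₁ k ((le_max_left _ _).trans_lt hk)
  obtain ⟨q₂, p₂, hq₂, hp₂, hq₂per, hp₂per, hq₂d, hp₂d, hq₂mem⟩ :=
    hk₂ k ((le_max_right _ _).trans_lt hk)
  refine ⟨q₁, p₁, q₂, p₂, hq₁, hp₁, hq₂, hp₂, hq₁per, hp₁per, hq₂per, hp₂per, hq₁d, hp₁d, hq₂d,
    hp₂d, fun heq => ?_, hq₁mem, hq₂mem⟩
  have hq : q₁ 0 = q₂ 0 := congrFun (Prod.mk.inj heq).1 0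
  linarith [(hq₁mem 0).2, (hq₂mem 0).1]
end

section
/- Let T > 0, μ ≥ 0, M ≥ 0, H ≥ 0. Then there exists a constant c > 0, depending only on T, μ, M and H, such that for every k ∈ ℕ, every C^∞ function φ : ℝ → ℝ with |φ| ≤ M, every C^∞ function σ : ℝ → ℝ with |σ| ≤ 1, every C^∞ function h : ℝ × ℝ × ℝ → ℝ with |h| ≤ H, and every T-periodic C¹ solution (q, p) of the system q̇ = p − σ(q)·φ(kt)·sin q, ṗ = −μp + σ(q)·(μ sin q + p cos q)·φ(kt) − sin q − (φ(kt)²/2)·sin 2q + h(q, p, t), one has |p(t)| ≤ c for all t ∈ ℝ. -/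
open Real

theorem abs_half_sq_mul_sin_le {φ M : ℝ} (hφ : |φ| ≤ M) (x : ℝ) :
    |φ ^ 2 / 2 * sin x| ≤ M ^ 2 / 2 := by
  rw [abs_mul, abs_of_nonneg (by positivity)]
  have h₁ : φ ^ 2 ≤ M ^ 2 := sq_le_sq' (abs_le.1 hφ).1 (abs_le.1 hφ).2
  calc φ ^ 2 / 2 * |sin x| ≤ φ ^ 2 / 2 * 1 := by gcongr; exact abs_sin_le_one x
    _ ≤ M ^ 2 / 2 := by linarith

theorem abs_cutoff_mul_le {s φ M : ℝ} (hs : |s| ≤ 1) (hφ : |φ| ≤ M) : |s * φ| ≤ M := by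
  rw [abs_mul]
  nlinarith [abs_nonneg s, abs_nonneg φ]

/-- The vector field of the momentum grows at most affinely in the momentum. -/
theorem abs_momentum_field_le {μ M H s φ η : ℝ} (hμ : 0 ≤ μ) (hs : |s| ≤ 1) (hφ : |φ| ≤ M)
    (hη : |η| ≤ H) (q p : ℝ) :
    |-μ * p + s * (μ * sin q + p * cos q) * φ - sin q - φ ^ 2 / 2 * sin (2 * q) + η| ≤
      (μ + M) * |p| + (μ * M + 1 + M ^ 2 / 2 + H) := by
  have hM : 0 ≤ M := (abs_nonneg φ).trans hφ
  have hfriction : |-μ * p| = μ * |p| := by rw [abs_mul, abs_neg, abs_of_nonneg hμ]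
  have htrig : |μ * sin q + p * cos q| ≤ μ + |p| := by
    refine (abs_add_le _ _).trans ?_
    rw [abs_mul, abs_mul, abs_of_nonneg hμ]
    gcongr
    · exact mul_le_of_le_one_right hμ (abs_sin_le_one q)
    · exact mul_le_of_le_one_right (abs_nonneg p) (abs_cos_le_one q)
  have hcutoff : |s * (μ * sin q + p * cos q) * φ| ≤ M * (μ + |p|) := by
    rw [mul_right_comm, abs_mul]
    exact mul_le_mul (abs_cutoff_mul_le hs hφ) htrig (abs_nonneg _) hM
  have hsq := abs_half_sq_mul_sin_le hφ (2 * q)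
  have hsin := abs_sin_le_one q
  rw [abs_le] at *
  have := abs_le.1 hfriction.le
  constructor <;> linarith

theorem exists_deriv_eq_zero_of_periodic {q : ℝ → ℝ} {T : ℝ} (hT : 0 < T) (hq : Continuous q)
    (hper : Function.Periodic q T) : ∃ t, deriv q t = 0 := by
  obtain ⟨t, -, ht⟩ := exists_deriv_eq_zero hT hq.continuousOn (by simpa using (hper 0).symm)
  exact ⟨t, ht⟩

/-- Grönwall's estimate over one period for a periodic function. -/
theorem abs_le_gronwallBound_of_periodic {p : ℝ → ℝ} {T δ K ε t₀ : ℝ} (hT : 0 < T) (hδ : 0 ≤ δ)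
    (hK : 0 ≤ K) (hε : 0 ≤ ε) (hp : Differentiable ℝ p) (hper : Function.Periodic p T)
    (h₀ : |p t₀| ≤ δ) (hbound : ∀ t, |deriv p t| ≤ K * |p t| + ε) (t : ℝ) :
    |p t| ≤ gronwallBound δ K ε T := by
  obtain ⟨s, hs, hts⟩ := hper.exists_mem_Ico hT t t₀
  rw [hts]
  refine (norm_le_gronwallBound_of_norm_deriv_right_le (b := t₀ + T) hp.continuous.continuousOn
    (fun x _ => (hp x).hasDerivAt.hasDerivWithinAt) h₀ (fun x _ => hbound x) s
    ⟨hs.1, hs.2.le⟩).trans ?_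
  exact gronwallBound_mono hδ hε hK (by linarith [hs.2])

/-- A priori estimate for the momentum along `T`-periodic solutions of the
modified Kapitza–Whitney system: there is a bound `c` depending only on
`T, μ, M, H` (in particular independent of `k`, the cutoff `σ`, and the
particular `φ`, `h` within the given bounds). -/
theorem momentum_a_priori_bound_for_periodic_solutions
    (T μ M H : ℝ) (hT : 0 < T) (hμ : 0 ≤ μ) (hM : 0 ≤ M) (hH : 0 ≤ H) :
    ∃ c : ℝ, 0 < c ∧
      ∀ (k : ℕ) (φ σ : ℝ → ℝ) (h : ℝ → ℝ → ℝ → ℝ),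
        ContDiff ℝ (⊤ : ℕ∞) φ → (∀ τ : ℝ, |φ τ| ≤ M) →
        ContDiff ℝ (⊤ : ℕ∞) σ → (∀ s : ℝ, |σ s| ≤ 1) →
        ContDiff ℝ (⊤ : ℕ∞) (fun x : ℝ × ℝ × ℝ => h x.1 x.2.1 x.2.2) →
        (∀ a b t : ℝ, |h a b t| ≤ H) →
        ∀ q p : ℝ → ℝ,
          ContDiff ℝ 1 q → ContDiff ℝ 1 p →
          Function.Periodic q T → Function.Periodic p T →
          (∀ t : ℝ, deriv q t = p t - σ (q t) * φ (k * t) * sin (q t)) →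
          (∀ t : ℝ, deriv p t =
            -μ * p t + σ (q t) * (μ * sin (q t) + p t * cos (q t)) * φ (k * t)
              - sin (q t) - (φ (k * t)) ^ 2 / 2 * sin (2 * q t)
              + h (q t) (p t) t) →
          ∀ t : ℝ, |p t| ≤ c := by
  refine ⟨|gronwallBound M (μ + M) (μ * M + 1 + M ^ 2 / 2 + H) T| + 1, by positivity, ?_⟩
  intro k φ σ h _ hφ _ hσ _ hh q p hq hp hqper hpper hdq hdp t
  obtain ⟨t₀, ht₀⟩ := exists_deriv_eq_zero_of_periodic hT hq.continuous hqper
  have h₀ : |p t₀| ≤ M := by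
    have hp₀ : p t₀ = σ (q t₀) * φ (k * t₀) * sin (q t₀) := by linarith [hdq t₀]
    rw [hp₀, abs_mul]
    exact (mul_le_of_le_one_right (abs_nonneg _) (abs_sin_le_one _)).trans
      (abs_cutoff_mul_le (hσ _) (hφ _))
  have hbound (s : ℝ) :
      |deriv p s| ≤ (μ + M) * |p s| + (μ * M + 1 + M ^ 2 / 2 + H) := by
    rw [hdp s]
    exact abs_momentum_field_le hμ (hσ _) (hφ _) (hh _ _ _) _ _
  have hle := abs_le_gronwallBound_of_periodic hT hM (by positivity) (by positivity)
    (hp.differentiable one_ne_zero) hpper h₀ hbound t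
  linarith [le_abs_self (gronwallBound M (μ + M) (μ * M + 1 + M ^ 2 / 2 + H) T)]
end

section
/- Let μ ≥ 0, Φ ≥ 0, and let h : ℝ × ℝ × ℝ → ℝ be C^∞ with h(π/2, 0, t) < 1 for all t ∈ ℝ. Let q : I → ℝ be a C² solution of q̈ = −μq̇ − sin q − (Φ/2)·sin 2q + h(q, q̇, t) on an open interval I, and let t₀ ∈ I with q(t₀) = π/2. Then for every ε > 0 there exists t ∈ I with 0 < |t − t₀| < ε and q(t) < π/2. -/
open Real

/-- `q = π/2` is a point of strict egress for the averaged Kapitza–Whitney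
equation `q̈ = -μq̇ - sin q - (Φ/2) sin 2q + h(q, q̇, t)` when
`h(π/2, 0, t) < 1`: a solution touching `π/2` visits the region `q < π/2`
at times arbitrarily close to the touching time. -/
theorem averaged_system_strict_egress_at_pi_div_two
    (μ Φ : ℝ) (hμ : 0 ≤ μ) (hΦ : 0 ≤ Φ)
    (h : ℝ → ℝ → ℝ → ℝ)
    (hsmooth : ContDiff ℝ (⊤ : ℕ∞) (fun x : ℝ × ℝ × ℝ => h x.1 x.2.1 x.2.2))
    (hlt : ∀ t : ℝ, h (π / 2) 0 t < 1)
    (a b : ℝ) (q : ℝ → ℝ)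
    (hq : ContDiffOn ℝ 2 q (Set.Ioo a b))
    (heq : ∀ t ∈ Set.Ioo a b,
      deriv (deriv q) t =
        -μ * deriv q t - sin (q t) - Φ / 2 * sin (2 * q t)
          + h (q t) (deriv q t) t)
    (t₀ : ℝ) (ht₀ : t₀ ∈ Set.Ioo a b) (hq0 : q t₀ = π / 2) :
    ∀ ε > 0, ∃ t ∈ Set.Ioo a b,
      0 < |t - t₀| ∧ |t - t₀| < ε ∧ q t < π / 2 := by
  intro ε hε
  by_contra! hcon
  have hmin : IsLocalMin q t₀ := by
    filter_upwards [isOpen_Ioo.mem_nhds ht₀, Metric.ball_mem_nhds t₀ hε] with t ht htε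
    rw [hq0]
    rcases eq_or_ne t t₀ with rfl | hne
    · exact hq0.ge
    · exact hcon t ht (abs_pos.2 (sub_ne_zero.2 hne)) htε
  have hd : deriv q t₀ = 0 := hmin.deriv_eq_zero
  have hdd : deriv (deriv q) t₀ < 0 := by
    rw [heq t₀ ht₀, hd, hq0, mul_div_cancel₀ π two_ne_zero, sin_pi, sin_pi_div_two]
    linarith [hlt t₀]
  have hmax : IsLocalMax q t₀ :=
    isLocalMax_of_deriv_deriv_neg hdd hd
      (hq.continuousOn.continuousAt (isOpen_Ioo.mem_nhds ht₀))
  have hconst : q =ᶠ[nhds t₀] fun _ => q t₀ := by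
    filter_upwards [hmin, hmax] with t h₁ h₂ using le_antisymm h₂ h₁
  have hzero : deriv (deriv q) t₀ = 0 := by
    rw [hconst.deriv.deriv_eq]
    simp
  exact hdd.ne hzero
end

section
/- Let μ ≥ 0, Φ ≥ 0, and let h : ℝ × ℝ × ℝ → ℝ be C^∞ with h(3π/2, 0, t) > −1 for all t ∈ ℝ. Let q : I → ℝ be a C² solution of q̈ = −μq̇ − sin q − (Φ/2)·sin 2q + h(q, q̇, t) on an open interval I, and let t₀ ∈ I with q(t₀) = 3π/2. Then for every ε > 0 there exists t ∈ I with 0 < |t − t₀| < ε and q(t) > 3π/2. -/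
open Real

/-- A function that is continuous at a local maximum has nonpositive second derivative there. -/
theorem IsLocalMax.deriv_deriv_nonpos {f : ℝ → ℝ} {x : ℝ} (hmax : IsLocalMax f x)
    (hf : ContinuousAt f x) : deriv (deriv f) x ≤ 0 := by
  by_contra! hpos
  have hmin : IsLocalMin f x := isLocalMin_of_deriv_deriv_pos hpos hmax.deriv_eq_zero hf
  have hconst : f =ᶠ[nhds x] fun _ => f x := by
    filter_upwards [hmax, hmin] with y h₁ h₂ using le_antisymm h₁ h₂
  have hzero : deriv (deriv f) x = 0 := by simp [hconst.deriv.deriv_eq]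
  exact hpos.ne' hzero

/-- `q = 3π/2` is a point of strict egress for the averaged Kapitza–Whitney
equation `q̈ = -μq̇ - sin q - (Φ/2) sin 2q + h(q, q̇, t)` when
`h(3π/2, 0, t) > -1`: a solution touching `3π/2` visits the region `q > 3π/2`
at times arbitrarily close to the touching time. -/
theorem averaged_system_strict_egress_at_three_pi_div_two
    (μ Φ : ℝ) (hμ : 0 ≤ μ) (hΦ : 0 ≤ Φ)
    (h : ℝ → ℝ → ℝ → ℝ)
    (hsmooth : ContDiff ℝ (⊤ : ℕ∞) (fun x : ℝ × ℝ × ℝ => h x.1 x.2.1 x.2.2))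
    (hgt : ∀ t : ℝ, h (3 * π / 2) 0 t > -1)
    (a b : ℝ) (q : ℝ → ℝ)
    (hq : ContDiffOn ℝ 2 q (Set.Ioo a b))
    (heq : ∀ t ∈ Set.Ioo a b,
      deriv (deriv q) t =
        -μ * deriv q t - sin (q t) - Φ / 2 * sin (2 * q t)
          + h (q t) (deriv q t) t)
    (t₀ : ℝ) (ht₀ : t₀ ∈ Set.Ioo a b) (hq0 : q t₀ = 3 * π / 2) :
    ∀ ε > 0, ∃ t ∈ Set.Ioo a b,
      0 < |t - t₀| ∧ |t - t₀| < ε ∧ q t > 3 * π / 2 := by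
  intro ε hε
  by_contra! hle
  have hmax : IsLocalMax q t₀ := by
    filter_upwards [Ioo_mem_nhds ht₀.1 ht₀.2, Metric.ball_mem_nhds t₀ hε] with t ht htε
    rcases eq_or_ne t t₀ with rfl | hne
    · exact le_rfl
    · rw [hq0]
      exact hle t ht (abs_pos.mpr (sub_ne_zero.mpr hne)) htε
  have hcont : ContinuousAt q t₀ :=
    hq.continuousOn.continuousAt (Ioo_mem_nhds ht₀.1 ht₀.2)
  have hsin : sin (3 * π / 2) = -1 := by
    rw [show 3 * π / 2 = π / 2 + π by ring, sin_add_pi, sin_pi_div_two]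
  have hsin2 : sin (2 * (3 * π / 2)) = 0 := by
    rw [show 2 * (3 * π / 2) = (3 : ℕ) * π by push_cast; ring, sin_nat_mul_pi]
  have hacc := heq t₀ ht₀
  rw [hmax.deriv_eq_zero, hq0, hsin, hsin2] at hacc
  linarith [hgt t₀, hmax.deriv_deriv_nonpos hcont]
end

section
/- Let T > 0, μ ≥ 0, Φ ≥ 0, c > 0, and let h : ℝ × ℝ × ℝ → ℝ be C^∞, bounded, T-periodic in its last argument, with h(π/2, 0, t) < 1 and h(3π/2, 0, t) > −1 for all t ∈ ℝ. Then there exist δ > 0, Δ > 0 and L > 0 such that for every globally defined C¹ solution (q, p) : ℝ → ℝ² of the system q̇ = p, ṗ = −μp − sin q − (Φ/2)·sin 2q + h(q, p, t) whose initial condition satisfies t₀ ∈ [0, T], p(t₀) ∈ [−2c, 2c], and q(t₀) ∈ [π/2, π/2 + δ] ∪ [3π/2 − δ, 3π/2], there exists l ∈ [0, L] for which at least one of the following holds: q(t₀ + l) ≤ π/2 − Δ, q(t₀ + l) ≥ 3π/2 + Δ, q(t₀ − l) ≤ π/2 − Δ, or q(t₀ − l) ≥ 3π/2 + Δ. -/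
open Real

/-- A continuous function, periodic in its last variable and negative along `{z₀} × ℝ`, is bounded
away from zero on a uniform neighborhood of `{z₀} × ℝ`. -/
lemma exists_uniform_neg_of_periodic {Z : Type*} [PseudoMetricSpace Z] {T : ℝ} (hT : 0 < T)
    {G : Z → ℝ → ℝ} (hG : Continuous fun y : Z × ℝ => G y.1 y.2)
    (hper : ∀ z, Function.Periodic (G z) T) (z₀ : Z) (hneg : ∀ t, G z₀ t < 0) :
    ∃ ε > 0, ∃ a > 0, ∀ z t, dist z z₀ ≤ ε → G z t ≤ -a := by
  have hGz : Continuous (G z₀) := hG.comp (by fun_prop : Continuous fun t : ℝ => (z₀, t))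
  obtain ⟨s, -, hs⟩ := (isCompact_Icc (a := (0 : ℝ)) (b := T)).exists_isMaxOn
    ⟨0, le_rfl, hT.le⟩ hGz.continuousOn
  set a : ℝ := -(G z₀ s) / 2 with ha
  have ha0 : 0 < a := by have := hneg s; linarith
  have hopen : IsOpen {y : Z × ℝ | G y.1 y.2 < -a} := isOpen_lt hG continuous_const
  obtain ⟨U, V, hU, -, hzU, hV, hUV⟩ := generalized_tube_lemma
    (isCompact_singleton (x := z₀)) (isCompact_Icc (a := (0 : ℝ)) (b := T)) hopen (by
      rintro ⟨z, t⟩ ⟨hz, ht⟩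
      obtain rfl : z = z₀ := hz
      have := hs ht
      simp only [Set.mem_ofPred_eq] at this ⊢
      linarith)
  obtain ⟨r, hr, hrU⟩ := Metric.isOpen_iff.1 hU z₀ (hzU rfl)
  refine ⟨r / 2, by positivity, a, ha0, fun z t hz => ?_⟩
  obtain ⟨t', ht', htt'⟩ := (hper z).exists_mem_Ico₀ hT t
  rw [htt']
  have hzr : z ∈ U := hrU (Metric.mem_ball.2 (by linarith))
  exact le_of_lt (hUV (Set.mk_mem_prod hzr (hV (Set.Ico_subset_Icc_self ht'))))

/-- If the acceleration of a moving point is less than `-b` whenever its position and velocity are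
at most `ε` in absolute value, and the initial velocity is nonpositive, then as long as the position
stays in `[-ε, ε]` the displacement is at most that of uniform acceleration `-b`. -/
lemma le_sub_of_accel_lt {x v w : ℝ → ℝ} {ε b S : ℝ} (hb : 0 ≤ b) (hS : 0 ≤ S) (hbS : b * S ≤ ε)
    (hx : ∀ s, HasDerivAt x (v s) s) (hv : ∀ s, HasDerivAt v (w s) s)
    (hw : ∀ s, |x s| ≤ ε → |v s| ≤ ε → w s < -b)
    (hxS : ∀ s ∈ Set.Ico 0 S, |x s| ≤ ε) (hv0 : v 0 ≤ 0) :
    x S ≤ x 0 - b * S ^ 2 / 2 := by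
  have hvs : ∀ ⦃s⦄, s ∈ Set.Icc 0 S → v s ≤ -b * s := by
    refine image_le_of_deriv_right_lt_deriv_boundary (f' := w) (B' := fun _ => -b)
      (fun s _ => (hv s).continuousAt.continuousWithinAt) (fun s _ => (hv s).hasDerivWithinAt)
      (by simpa using hv0) (fun s => hasDerivAt_const_mul (-b)) ?_
    intro s hs hvs
    refine hw s (hxS s hs) ?_
    have h1 : b * s ≤ b * S := mul_le_mul_of_nonneg_left hs.2.le hb
    have h2 : 0 ≤ b * s := mul_nonneg hb hs.1
    rw [hvs, abs_le]
    constructor <;> linarith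
  refine image_le_of_deriv_right_le_deriv_boundary (a := 0) (b := S) (f' := v)
    (B := fun s => x 0 - b * s ^ 2 / 2) (B' := fun s => -b * s)
    (fun s _ => (hx s).continuousAt.continuousWithinAt) (fun s _ => (hx s).hasDerivWithinAt)
    (by simp) (by fun_prop) (fun s _ => ?_) (fun s hs => hvs (Set.Ico_subset_Icc_self hs))
    (Set.right_mem_Icc.2 hS)
  have : HasDerivAt (fun s : ℝ => x 0 - b * s ^ 2 / 2) (-b * s) s := by
    refine ((((hasDerivAt_pow 2 s).const_mul b).div_const 2).const_sub (x 0)).congr_deriv ?_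
    push_cast
    ring
  exact this.hasDerivWithinAt

/-- A point starting close to the origin with nonpositive velocity, whose acceleration is at most
`-a` at all small positions and velocities, reaches the negative side in uniformly bounded time. -/
lemma exists_forward_escape {ε a : ℝ} (hε : 0 < ε) (ha : 0 < a) :
    ∃ d > 0, ∃ L > 0, ∀ x v w : ℝ → ℝ,
      (∀ s, HasDerivAt x (v s) s) → (∀ s, HasDerivAt v (w s) s) →
      (∀ s, |x s| ≤ ε → |v s| ≤ ε → w s ≤ -a) → x 0 ≤ d → v 0 ≤ 0 →
      ∃ l ∈ Set.Icc 0 L, x l ≤ -d := by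
  set d := min (ε / 2) (ε ^ 2 / (2 * a))
  have hd0 : 0 < d := by positivity
  have hd1 : d ≤ ε / 2 := min_le_left _ _
  have hd2 : d ≤ ε ^ 2 / (2 * a) := min_le_right _ _
  set L := 2 * ε / a with hL
  have hL0 : 0 < L := by positivity
  refine ⟨d, hd0, L, hL0, fun x v w hx hv hw hx0 hv0 => ?_⟩
  by_contra! hcon
  have hbL : a / 2 * L = ε := by rw [hL]; field_simp
  have hw' : ∀ s, |x s| ≤ ε → |v s| ≤ ε → w s < -(a / 2) := fun s h1 h2 => by
    have := hw s h1 h2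
    linarith
  have key : ∀ S ∈ Set.Icc 0 L, (∀ s ∈ Set.Ico 0 S, x s < ε) →
      x S ≤ x 0 - a / 2 * S ^ 2 / 2 := fun S hS hlt =>
    le_sub_of_accel_lt (by positivity) hS.1
      (hbL ▸ mul_le_mul_of_nonneg_left hS.2 (by positivity)) hx hv hw'
      (fun s hs => abs_le.2 ⟨by linarith [hcon s ⟨hs.1, hs.2.le.trans hS.2⟩], (hlt s hs).le⟩) hv0
  have hlt : ∀ s ∈ Set.Icc 0 L, x s < ε := by
    by_contra! hex
    have hxc : Continuous x := continuous_iff_continuousAt.2 fun s => (hx s).continuousAt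
    obtain ⟨S, ⟨hS, hSε⟩, hmin⟩ := ((isCompact_Icc (a := (0 : ℝ)) (b := L)).inter_right
      (isClosed_le continuous_const hxc : IsClosed {s | ε ≤ x s})).exists_isLeast hex
    have h1 := key S hS fun s hs => by
      by_contra! hge
      exact absurd (hmin ⟨⟨hs.1, hs.2.le.trans hS.2⟩, hge⟩) (not_le.2 hs.2)
    have h2 : 0 ≤ a / 2 * S ^ 2 / 2 := by positivity
    have h3 : ε ≤ x S := hSε
    linarith
  have hend := key L ⟨hL0.le, le_rfl⟩ fun s hs => hlt s (Set.Ico_subset_Icc_self hs)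
  have h4 : a / 2 * L ^ 2 / 2 = 2 * (ε ^ 2 / (2 * a)) := by
    rw [hL]
    field_simp
  linarith [hcon L ⟨hL0.le, le_rfl⟩]

/-- Two-sided version of `exists_forward_escape`, with no condition on the initial velocity. -/
lemma exists_escape {ε a : ℝ} (hε : 0 < ε) (ha : 0 < a) :
    ∃ d > 0, ∃ L > 0, ∀ x v w : ℝ → ℝ,
      (∀ s, HasDerivAt x (v s) s) → (∀ s, HasDerivAt v (w s) s) →
      (∀ s, |x s| ≤ ε → |v s| ≤ ε → w s ≤ -a) → ∀ t, x t ≤ d →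
      ∃ l ∈ Set.Icc 0 L, x (t + l) ≤ -d ∨ x (t - l) ≤ -d := by
  obtain ⟨d, hd, L, hL, H⟩ := exists_forward_escape hε ha
  refine ⟨d, hd, L, hL, fun x v w hx hv hw t hxt => ?_⟩
  rcases le_total (v t) 0 with hvt | hvt
  · obtain ⟨l, hl, hxl⟩ := H (fun s => x (t + s)) (fun s => v (t + s)) (fun s => w (t + s))
      (fun s => (hx (t + s)).comp_const_add t s) (fun s => (hv (t + s)).comp_const_add t s)
      (fun s => hw (t + s)) (by simpa using hxt) (by simpa using hvt)
    exact ⟨l, hl, Or.inl hxl⟩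
  · obtain ⟨l, hl, hxl⟩ := H (fun s => x (t - s)) (fun s => -v (t - s)) (fun s => w (t - s))
      (fun s => (hx (t - s)).comp_const_sub t s)
      (fun s => by simpa using ((hv (t - s)).comp_const_sub t s).fun_neg)
      (fun s h1 h2 => hw (t - s) h1 (by simpa using h2)) (by simpa using hxt) (by simpa using hvt)
    exact ⟨l, hl, Or.inr hxl⟩

/-- Uniform escape property for the averaged Kapitza–Whitney system
`q̇ = p`, `ṗ = -μp - sin q - (Φ/2) sin 2q + h(q,p,t)`: there exist `δ, Δ, L > 0`
such that every globally defined `C¹` solution whose state at some time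
`t₀ ∈ [0,T]` has `p(t₀) ∈ [-2c, 2c]` and `q(t₀)` within `δ` of the boundary of
the strip `[π/2, 3π/2]` leaves the `Δ`-neighborhood of the strip, in forward
or backward time at most `L`. -/
theorem averaged_system_uniform_escape_near_boundary
    (T μ Φ c : ℝ) (hT : 0 < T) (hμ : 0 ≤ μ) (hΦ : 0 ≤ Φ) (hc : 0 < c)
    (h : ℝ → ℝ → ℝ → ℝ)
    (hsmooth : ContDiff ℝ (⊤ : ℕ∞) (fun x : ℝ × ℝ × ℝ => h x.1 x.2.1 x.2.2))
    (hbdd : ∃ C : ℝ, ∀ a b t : ℝ, |h a b t| ≤ C)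
    (hper : ∀ a b : ℝ, Function.Periodic (h a b) T)
    (h1 : ∀ t : ℝ, h (π / 2) 0 t < 1)
    (h2 : ∀ t : ℝ, h (3 * π / 2) 0 t > -1) :
    ∃ δ > (0:ℝ), ∃ Δ > (0:ℝ), ∃ L > (0:ℝ),
      ∀ q p : ℝ → ℝ,
        ContDiff ℝ 1 q → ContDiff ℝ 1 p →
        (∀ t : ℝ, deriv q t = p t) →
        (∀ t : ℝ, deriv p t =
          -μ * p t - sin (q t) - Φ / 2 * sin (2 * q t) + h (q t) (p t) t) →
        ∀ t₀ : ℝ, t₀ ∈ Set.Icc (0 : ℝ) T →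
          p t₀ ∈ Set.Icc (-(2 * c)) (2 * c) →
          q t₀ ∈ Set.Icc (π / 2) (π / 2 + δ) ∪
                 Set.Icc (3 * π / 2 - δ) (3 * π / 2) →
          ∃ l ∈ Set.Icc (0:ℝ) L,
            q (t₀ + l) ≤ π / 2 - Δ ∨
            q (t₀ + l) ≥ 3 * π / 2 + Δ ∨
            q (t₀ - l) ≤ π / 2 - Δ ∨
            q (t₀ - l) ≥ 3 * π / 2 + Δ := by
  have hcont : Continuous fun y : ℝ × ℝ × ℝ => h y.1 y.2.1 y.2.2 := hsmooth.continuous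
  have hF : Continuous fun y : (ℝ × ℝ) × ℝ =>
      -μ * y.1.2 - sin y.1.1 - Φ / 2 * sin (2 * y.1.1) + h y.1.1 y.1.2 y.2 := by
    have := hcont.comp (by fun_prop : Continuous fun y : (ℝ × ℝ) × ℝ => (y.1.1, y.1.2, y.2))
    exact Continuous.add (by fun_prop) this
  have hs1 : sin (2 * (π / 2)) = 0 := by rw [mul_div_cancel₀ _ two_ne_zero, sin_pi]
  have hs2 : sin (3 * π / 2) = -1 := by
    rw [show 3 * π / 2 = π / 2 + π by ring, sin_add_pi, sin_pi_div_two]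
  have hs3 : sin (2 * (3 * π / 2)) = 0 := by
    rw [show 2 * (3 * π / 2) = π + 2 * π by ring, sin_add_two_pi, sin_pi]
  obtain ⟨ε₁, hε₁, a₁, ha₁, H₁⟩ := exists_uniform_neg_of_periodic hT
    (G := fun (z : ℝ × ℝ) t => -μ * z.2 - sin z.1 - Φ / 2 * sin (2 * z.1) + h z.1 z.2 t) hF
    (fun z t => by simp only [(hper z.1 z.2) t]) (π / 2, 0) (fun t => by
      have := h1 t
      simp only [hs1, sin_pi_div_two]
      linarith)
  obtain ⟨ε₂, hε₂, a₂, ha₂, H₂⟩ := exists_uniform_neg_of_periodic hT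
    (G := fun (z : ℝ × ℝ) t => -(-μ * z.2 - sin z.1 - Φ / 2 * sin (2 * z.1) + h z.1 z.2 t)) hF.neg
    (fun z t => by simp only [(hper z.1 z.2) t]) (3 * π / 2, 0) (fun t => by
      have := h2 t
      simp only [hs2, hs3]
      linarith)
  obtain ⟨d₁, hd₁, L₁, hL₁, E₁⟩ := exists_escape hε₁ ha₁
  obtain ⟨d₂, hd₂, L₂, hL₂, E₂⟩ := exists_escape hε₂ ha₂
  refine ⟨min d₁ d₂, lt_min hd₁ hd₂, min d₁ d₂, lt_min hd₁ hd₂, max L₁ L₂, lt_max_of_lt_left hL₁,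
    fun q p hq hp hdq hdp t₀ _ _ hq₀ => ?_⟩
  have hm₁ : min d₁ d₂ ≤ d₁ := min_le_left _ _
  have hm₂ : min d₁ d₂ ≤ d₂ := min_le_right _ _
  have hq' : ∀ s, HasDerivAt q (p s) s := fun s =>
    hdq s ▸ (hq.differentiable one_ne_zero s).hasDerivAt
  have hp' : ∀ s, HasDerivAt p (deriv p s) s := fun s =>
    (hp.differentiable one_ne_zero s).hasDerivAt
  rcases hq₀ with hq₀ | hq₀
  · obtain ⟨l, hl, hlq⟩ := E₁ (fun s => q s - π / 2) p (deriv p)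
      (fun s => (hq' s).sub_const _) hp'
      (fun s hs hv => by
        rw [hdp s]
        exact H₁ (q s, p s) s (by simpa [Prod.dist_eq, Real.dist_eq] using ⟨hs, hv⟩))
      t₀ (by linarith [hq₀.2])
    refine ⟨l, ⟨hl.1, hl.2.trans (le_max_left _ _)⟩, ?_⟩
    rcases hlq with hlq | hlq
    · exact Or.inl (by linarith)
    · exact Or.inr (Or.inr (Or.inl (by linarith)))
  · obtain ⟨l, hl, hlq⟩ := E₂ (fun s => 3 * π / 2 - q s) (fun s => -p s) (fun s => -deriv p s)
      (fun s => (hq' s).const_sub _) (fun s => (hp' s).neg)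
      (fun s hs hv => by
        rw [hdp s]
        exact H₂ (q s, p s) s (by
          rw [abs_sub_comm] at hs
          simpa [Prod.dist_eq, Real.dist_eq] using ⟨hs, (abs_neg (p s)) ▸ hv⟩))
      t₀ (by linarith [hq₀.1])
    refine ⟨l, ⟨hl.1, hl.2.trans (le_max_right _ _)⟩, ?_⟩
    rcases hlq with hlq | hlq
    · exact Or.inr (Or.inl (by linarith))
    · exact Or.inr (Or.inr (Or.inr (by linarith)))
end

section
/- Let Φ > 1, set λ₂(Φ) = (−1 − √(1+8Φ²))/(4Φ), q_max² = arccos(λ₂(Φ)), q_min² = 2π − arccos(λ₂(Φ)), and f_Φ(q) = −sin q − (Φ/2)·sin(2q). Then q_max² ∈ (3π/4, π), q_min² ∈ (π, 5π/4), f_Φ(q_max²) > 0, and f_Φ(q_min²) < 0. -/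
open Real

/-- The smaller root of `2Φx² + x - Φ` lies in `(-1, -√2/2)` when `Φ > 1`. -/
lemma critical_cos_mem_Ioo {Φ : ℝ} (hΦ : 1 < Φ) :
    (-1 - √(1 + 8 * Φ ^ 2)) / (4 * Φ) ∈ Set.Ioo (-1) (-(√2 / 2)) := by
  have hpos : 0 < 4 * Φ := by linarith
  have hlt : √(1 + 8 * Φ ^ 2) < 4 * Φ - 1 := by
    rw [sqrt_lt' (by linarith)]
    nlinarith
  have hgt : 2 * √2 * Φ < √(1 + 8 * Φ ^ 2) := by
    apply lt_sqrt_of_sq_lt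
    rw [mul_pow, mul_pow, sq_sqrt zero_le_two]
    linarith
  constructor
  · rw [lt_div_iff₀ hpos]
    linarith
  · rw [div_lt_iff₀ hpos]
    linarith

lemma three_pi_div_four_lt_arccos {x : ℝ} (h₁ : -1 ≤ x) (h₂ : x < -(√2 / 2)) :
    3 * π / 4 < arccos x := by
  have hcos : cos (3 * π / 4) = -(√2 / 2) := by
    rw [← cos_pi_div_four, ← cos_pi_sub]
    congr 1
    ring
  rw [← arccos_cos (by positivity) (by linarith [pi_pos] : 3 * π / 4 ≤ π), hcos]
  exact arccos_lt_arccos h₁ h₂ (by linarith [sqrt_nonneg 2])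

/-- For `Φ > 1` the interior critical points `q_max² = arccos λ₂(Φ)` and
`q_min² = 2π - arccos λ₂(Φ)` of `f_Φ(q) = -sin q - (Φ/2) sin 2q` satisfy
`q_max² ∈ (3π/4, π)`, `q_min² ∈ (π, 5π/4)`, `f_Φ(q_max²) > 0` and
`f_Φ(q_min²) < 0`. -/
theorem averaged_force_sign_at_interior_critical_points
    (Φ lam2 qmax qmin : ℝ) (hΦ : 1 < Φ)
    (hlam2 : lam2 = (-1 - Real.sqrt (1 + 8 * Φ ^ 2)) / (4 * Φ))
    (hqmax : qmax = arccos lam2)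
    (hqmin : qmin = 2 * π - arccos lam2) :
    qmax ∈ Set.Ioo (3 * π / 4) π ∧
    qmin ∈ Set.Ioo π (5 * π / 4) ∧
    0 < -sin qmax - Φ / 2 * sin (2 * qmax) ∧
    -sin qmin - Φ / 2 * sin (2 * qmin) < 0 := by
  obtain ⟨h₁, h₂⟩ : lam2 ∈ Set.Ioo (-1) (-(√2 / 2)) := hlam2 ▸ critical_cos_mem_Ioo hΦ
  have hlow : 3 * π / 4 < arccos lam2 := three_pi_div_four_lt_arccos h₁.le h₂
  have hneg : lam2 < 0 := h₂.trans_le (by linarith [sqrt_nonneg 2])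
  have hcos : cos (arccos lam2) = lam2 := cos_arccos h₁.le (by linarith)
  have hup : arccos lam2 < π := by
    refine (arccos_le_pi lam2).lt_of_ne fun h => ?_
    rw [h, cos_pi] at hcos
    exact h₁.ne hcos
  have hsin : 0 < sin (arccos lam2) := sin_pos_of_pos_of_lt_pi (by linarith [pi_pos]) hup
  have hfactor : 1 + Φ * lam2 < 0 := by
    have hsqrt : 3 < √(1 + 8 * Φ ^ 2) := lt_sqrt_of_sq_lt (by nlinarith)
    have hmul : Φ * lam2 = (-1 - √(1 + 8 * Φ ^ 2)) / 4 := by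
      rw [hlam2]
      field_simp
    linarith
  have hforce : 0 < -sin (arccos lam2) - Φ / 2 * sin (2 * arccos lam2) := by
    rw [sin_two_mul, hcos]
    nlinarith [mul_pos_of_neg_of_neg (neg_neg_of_pos hsin) hfactor]
  subst hqmax hqmin
  refine ⟨⟨hlow, hup⟩, ⟨by linarith, by linarith⟩, hforce, ?_⟩
  rw [sin_two_mul, sin_two_pi_sub, cos_two_pi_sub]
  rw [sin_two_mul] at hforce
  linarith
end
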